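/- arXiv:2412.13792 — 3 statements merged into one kernel-verified Lean document; each statement's English description precedes it below -/
import Mathlib

section
/- Under the setup, the set W = V(G*) \ N[u*] spans no edges of G*, i.e., e(W) = 0. -/
open SimpleGraph Finset
open scoped Classical

/-- The spectral radius of a finite simple graph: the largest eigenvalue of its
adjacency matrix (expressed as the supremum of the set of eigenvalues). -/
noncomputable def specRad {V : Type*} [Fintype V] (G : SimpleGraph V) : ℝ :=
  sSup {t : ℝ | Module.End.HasEigenvalue (Matrix.toLin' (G.adjMatrix ℝ)) t}

/-- The fan graph `F₆ = K₁ ∨ P₅`: the path `0-1-2-3-4` together with the hub `5`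
adjacent to all of `0,…,4`. -/
def fan6 : SimpleGraph (Fin 6) :=
  SimpleGraph.fromRel (fun a b => b = 5 ∨ (b.val = a.val + 1 ∧ b.val ≤ 4))

/-- A graph is `F₆`-free if it contains no subgraph isomorphic to the fan `F₆`,
i.e. there is no injective graph homomorphism from `F₆` into it. -/
def F6Free {V : Type*} (G : SimpleGraph V) : Prop :=
  ¬ ∃ f : fan6 →g G, Function.Injective f

/-- The join `K₂ ∨ kK₁`: two adjacent vertices, each adjacent to `k` further
pairwise non-adjacent vertices. -/
def K2JoinEmpty (k : ℕ) : SimpleGraph (Fin 2 ⊕ Fin k) :=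
  SimpleGraph.fromRel (fun a b => a.isLeft ∨ b.isLeft)

/-- `dS G S v` is the number of neighbors of `v` lying in `S`. -/
noncomputable def dS {V : Type*} (G : SimpleGraph V) (S : Set V) (v : V) : ℕ :=
  (G.neighborSet v ∩ S).ncard

/-- `eIn G S` is the number of edges of the induced subgraph `G[S]`. -/
noncomputable def eIn {V : Type*} (G : SimpleGraph V) (S : Set V) : ℕ :=
  {e ∈ G.edgeSet | ∀ v ∈ e, v ∈ S}.ncard

/-- `eBetween G S T` is the number of edges with one endpoint in `S` and the
other in `T`. -/
noncomputable def eBetween {V : Type*} (G : SimpleGraph V) (S T : Set V) : ℕ :=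
  {e ∈ G.edgeSet | ∃ a ∈ S, ∃ b ∈ T, e = s(a, b)}.ncard

/-- `gamma G x ustar S = Σ_{u∈S} (d_S(u) - 1)·x_u/x_{u*} - e(S)`. -/
noncomputable def gamma {V : Type*} [Fintype V] (G : SimpleGraph V) (x : V → ℝ)
    (ustar : V) (S : Set V) : ℝ :=
  (∑ u ∈ S.toFinset, ((dS G S u : ℝ) - 1) * (x u / x ustar)) - eIn G S

/-- The star `K_{1,r}` with center `0` and `r` leaves. -/
def starGraph (r : ℕ) : SimpleGraph (Fin (r + 1)) :=
  SimpleGraph.fromRel (fun a _ => a = 0)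

/-- `K_{1,r} + e`: the star with center `0` and `r` leaves, plus an edge joining
the two leaves `1` and `2`. -/
def starPlusEdge (r : ℕ) : SimpleGraph (Fin (r + 1)) :=
  SimpleGraph.fromRel (fun a b => a = 0 ∨ (a = 1 ∧ b = 2))

/-- The double star `D_{a,b}`: centers `0` and `1` joined by an edge, `0` joined
to the `a` leaves `2,…,a+1`, and `1` joined to the `b` leaves `a+2,…,a+b+1`. -/
def doubleStar (a b : ℕ) : SimpleGraph (Fin (a + b + 2)) :=
  SimpleGraph.fromRel (fun u v =>
    (u.val = 0 ∧ v.val = 1) ∨ (u.val = 0 ∧ 2 ≤ v.val ∧ v.val < a + 2) ∨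
      (u.val = 1 ∧ a + 2 ≤ v.val))

/-- `K₄ - e`: the complete graph on 4 vertices minus the edge `{0,1}`. -/
def K4MinusE : SimpleGraph (Fin 4) :=
  SimpleGraph.fromRel (fun u v => ¬(u = 0 ∧ v = 1) ∧ ¬(u = 1 ∧ v = 0))

/-- An `F₆`-free graph contains no path `a b c d e` in the neighborhood of a vertex `h`. -/
theorem F6Free.not_fan {V : Type*} {G : SimpleGraph V} (hG : F6Free G) {h a b c d e : V}
    (ha : G.Adj h a) (hb : G.Adj h b) (hc : G.Adj h c) (hd : G.Adj h d) (he : G.Adj h e)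
    (hab : G.Adj a b) (hbc : G.Adj b c) (hcd : G.Adj c d) (hde : G.Adj d e)
    (hac : a ≠ c) (had : a ≠ d) (hae : a ≠ e) (hbd : b ≠ d) (hbe : b ≠ e) (hce : c ≠ e) :
    False := by
  refine hG ⟨⟨![a, b, c, d, e, h], ?_⟩, ?_⟩
  · intro i j hij
    fin_cases i <;> fin_cases j <;> simp [fan6] at hij ⊢ <;>
      first | assumption | (apply SimpleGraph.Adj.symm; assumption)
  · have := ha.ne; have := hb.ne; have := hc.ne; have := hd.ne; have := he.ne
    have := hab.ne; have := hbc.ne; have := hcd.ne; have := hde.ne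
    intro i j hij
    fin_cases i <;> fin_cases j <;> simp at hij ⊢ <;> grind

/-- The graph `H` contains no path on five vertices. -/
def NoPathFive {V : Type*} (H : SimpleGraph V) : Prop :=
  ∀ ⦃a b c d e : V⦄, H.Adj a b → H.Adj b c → H.Adj c d → H.Adj d e →
    a ≠ c → a ≠ d → a ≠ e → b ≠ d → b ≠ e → c ≠ e → False

theorem exists_adj_ne_of_degree_ne_one {V : Type*} [Fintype V] {H : SimpleGraph V}
    [DecidableRel H.Adj]
    {a v : V} (hav : H.Adj a v) (hv : H.degree v ≠ 1) :
    ∃ t, H.Adj v t ∧ t ≠ a := by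
  have hpos : 0 < H.degree v := (H.degree_pos_iff_exists_adj v).2 ⟨a, hav.symm⟩
  have h1 : 1 < (H.neighborFinset v).card := by
    rw [H.card_neighborFinset_eq_degree]; omega
  obtain ⟨t, ht, hta⟩ := Finset.exists_mem_ne h1 a
  exact ⟨t, by simpa using ht, hta⟩

theorem eq_of_adj_of_degree_eq_one {V : Type*} [Fintype V] {H : SimpleGraph V}
    [DecidableRel H.Adj]
    {v s t : V} (hv : H.degree v = 1) (hs : H.Adj v s)
    (ht : H.Adj v t) : s = t := by
  have h1 : (H.neighborFinset v).card ≤ 1 := by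
    rw [H.card_neighborFinset_eq_degree]; omega
  exact Finset.card_le_one.1 h1 s (by simpa using hs) t (by simpa using ht)

theorem NoPathFive.adj_of_adj {V : Type*} {H : SimpleGraph V} (hH : NoPathFive H)
    {a u v w s t : V} (hu : H.Adj a u)
    (hv : H.Adj a v) (hw : H.Adj a w) (huv : u ≠ v) (huw : u ≠ w) (hvw : v ≠ w)
    (hs : H.Adj u s) (hsa : s ≠ a) (ht : H.Adj v t) (hta : t ≠ a) : H.Adj a s := by
  by_contra has
  have hsv : s ≠ v := by rintro rfl; exact has hv
  have hsw : s ≠ w := by rintro rfl; exact has hw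
  by_cases hts : t = s
  · subst hts
    exact hH hw.symm hu hs ht.symm huw.symm hsw.symm hvw.symm hsa.symm hv.ne huv
  by_cases htu : t = u
  · subst htu
    exact hH hs.symm ht.symm hv.symm hw hsv hsa hsw hu.ne' huw hvw
  · exact hH hs.symm hu.symm hv ht hsa hsv (Ne.symm hts) huv (Ne.symm htu) hta.symm

/-- Among the neighbors of a vertex of degree at least four, at most two are not leaves. -/
theorem NoPathFive.card_filter_degree_ne_one_le {V : Type*} [Fintype V] [DecidableEq V]
    {H : SimpleGraph V} [DecidableRel H.Adj] (hH : NoPathFive H) {a : V} (ha : 4 ≤ H.degree a) :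
    ((H.neighborFinset a).filter (fun v => H.degree v ≠ 1)).card ≤ 2 := by
  by_contra! hcard
  obtain ⟨u, v, w, hu, hv, hw, huv, huw, hvw⟩ := Finset.two_lt_card_iff.1 hcard
  simp only [Finset.mem_filter, mem_neighborFinset] at hu hv hw
  obtain ⟨hu, hdu⟩ := hu
  obtain ⟨hv, hdv⟩ := hv
  obtain ⟨hw, hdw⟩ := hw
  obtain ⟨r, hr, hra⟩ := exists_adj_ne_of_degree_ne_one hu hdu
  obtain ⟨s, hs, hsa⟩ := exists_adj_ne_of_degree_ne_one hv hdv
  obtain ⟨t, ht, hta⟩ := exists_adj_ne_of_degree_ne_one hw hdw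
  have key : ∀ {u v w t : V}, H.Adj a u → H.Adj a v → H.Adj a w → u ≠ v → u ≠ w → v ≠ w →
      H.Adj u v → H.Adj w t → t ≠ a → False := by
    intro u v w t hu hv hw huv huw hvw huv' ht hta
    obtain ⟨z, hz, hzn⟩ : ∃ z ∈ H.neighborFinset a, z ∉ ({u, v, w} : Finset V) := by
      refine Finset.exists_mem_notMem_of_card_lt_card ?_
      rw [H.card_neighborFinset_eq_degree]
      exact lt_of_le_of_lt Finset.card_le_three (by omega)
    simp only [mem_neighborFinset, Finset.mem_insert, Finset.mem_singleton, not_or] at hz hzn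
    obtain ⟨hzu, hzv, hzw⟩ := hzn
    by_cases htu : t = u
    · subst htu
      exact hH ht huv' hv.symm hz hvw.symm hw.ne' (Ne.symm hzw) hu.ne' (Ne.symm hzu) (Ne.symm hzv)
    by_cases htv : t = v
    · subst htv
      exact hH ht huv'.symm hu.symm hz huw.symm hw.ne' (Ne.symm hzw) hv.ne' (Ne.symm hzv)
        (Ne.symm hzu)
    · exact hH ht.symm hw.symm hu huv' hta htu htv huw.symm hvw.symm hv.ne
  have har : H.Adj a r := hH.adj_of_adj hu hv hw huv huw hvw hr hra hs hsa
  by_cases hrv : r = v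
  · subst hrv
    exact key hu hv hw huv huw hvw hr ht hta
  · exact key hu har hv hr.ne huv hrv hr hs hsa

/-- The vertices of degree three in `H` without leaf neighbors; in a graph with no
path on five vertices these are the vertices of degree three of components `K₄` and `K₄ - e`. -/
noncomputable def coreVertices {V : Type*} [Fintype V] (H : SimpleGraph V)
    [DecidableRel H.Adj] : Finset V :=
  Finset.univ.filter (fun a => H.degree a = 3 ∧ ∀ v, H.Adj a v → H.degree v ≠ 1)

theorem NoPathFive.exists_twin {V : Type*} [Fintype V] [DecidableEq V]
    {H : SimpleGraph V} [DecidableRel H.Adj] (hH : NoPathFive H) {a : V}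
    (ha : a ∈ coreVertices H) :
    ∃ b ∈ coreVertices H, b ≠ a ∧
      insert a (H.neighborFinset a) = insert b (H.neighborFinset b) := by
  obtain ⟨hd, hl⟩ := (Finset.mem_filter.1 ha).2
  obtain ⟨u, v, w, huv, huw, hvw, hN⟩ := Finset.card_eq_three.1
    ((H.card_neighborFinset_eq_degree a).trans hd)
  have hadj : ∀ t, H.Adj a t ↔ t = u ∨ t = v ∨ t = w := by
    intro t
    rw [← mem_neighborFinset, hN]
    simp
  have hu := (hadj u).2 (by simp)
  have hv := (hadj v).2 (by simp)
  have hw := (hadj w).2 (by simp)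
  have key : ∀ u v w, H.Adj a u → H.Adj a v → H.Adj a w → u ≠ v → u ≠ w → v ≠ w →
      H.neighborFinset a = {u, v, w} → H.Adj u v → H.Adj u w →
      ∃ b ∈ coreVertices H, b ≠ a ∧
      insert a (H.neighborFinset a) = insert b (H.neighborFinset b) := by
    intro u v w hu hv hw huv huw hvw hN huv' huw'
    have hNu : H.neighborFinset u = {a, v, w} := by
      ext t
      simp only [mem_neighborFinset, Finset.mem_insert, Finset.mem_singleton]
      constructor
      · intro ht
        by_contra! hcon
        exact hH ht.symm huv' hv.symm hw hcon.2.1 hcon.1 hcon.2.2 hu.ne' huw hvw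
      · rintro (rfl | rfl | rfl)
        exacts [hu.symm, huv', huw']
    refine ⟨u, ?_, hu.ne', ?_⟩
    · refine Finset.mem_filter.2 ⟨Finset.mem_univ _, ?_, ?_⟩
      · rw [← H.card_neighborFinset_eq_degree, hNu]
        exact Finset.card_eq_three.2 ⟨a, v, w, hv.ne, hw.ne, hvw, rfl⟩
      · intro t ht
        have ht' : t = a ∨ t = v ∨ t = w := by
          rw [← mem_neighborFinset, hNu] at ht
          simpa using ht
        rcases ht' with rfl | rfl | rfl
        · omega
        · exact hl _ hv
        · exact hl _ hw
    · rw [hN, hNu]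
      ext t
      simp only [Finset.mem_insert, Finset.mem_singleton]
      tauto
  obtain ⟨r, hr, hra⟩ := exists_adj_ne_of_degree_ne_one hu (hl _ hu)
  obtain ⟨s, hs, hsa⟩ := exists_adj_ne_of_degree_ne_one hv (hl _ hv)
  obtain ⟨t, ht, hta⟩ := exists_adj_ne_of_degree_ne_one hw (hl _ hw)
  have har : H.Adj a r := hH.adj_of_adj hu hv hw huv huw hvw hr hra hs hsa
  have has : H.Adj a s := hH.adj_of_adj hv hu hw huv.symm hvw huw hs hsa hr hra
  have hat : H.Adj a t := hH.adj_of_adj hw hu hv huw.symm hvw.symm huv ht hta hr hra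
  have hN2 : H.neighborFinset a = {v, u, w} := by rw [hN]; ext; simp; tauto
  have hN3 : H.neighborFinset a = {w, u, v} := by rw [hN]; ext; simp; tauto
  have k1 := key u v w hu hv hw huv huw hvw hN
  have k2 := key v u w hv hu hw huv.symm hvw huw hN2
  have k3 := key w u v hw hu hv huw.symm hvw.symm huv hN3
  clear key hl hN hN2 hN3
  rw [hadj] at har has hat
  rcases har with rfl | rfl | rfl
  · exact absurd hr (H.irrefl)
  · rcases hat with rfl | rfl | rfl
    · exact k1 hr ht.symm
    · exact k2 hr.symm ht.symm
    · exact absurd ht (H.irrefl)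
  · rcases has with rfl | rfl | rfl
    · exact k1 hs.symm hr
    · exact absurd hs (H.irrefl)
    · exact k3 hr.symm hs.symm

theorem NoPathFive.exists_discharge {V : Type*} [Fintype V] [DecidableEq V]
    {H : SimpleGraph V} [DecidableRel H.Adj] (hH : NoPathFive H) {x : V → ℝ}
    (hx0 : ∀ v, 0 < x v) (hx1 : ∀ v, x v ≤ 1) {U : Finset V} (hU : ∀ u v, H.Adj u v → u ∈ U) :
    ∃ c : V → ℝ,
      ∑ u ∈ U, (((H.degree u : ℝ) - 1) * x u - (H.degree u : ℝ) / 2) = ∑ u ∈ U, c u ∧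
      (∀ u ∈ coreVertices H, c u = 2 * (x u - 3 / 4)) ∧
      (∀ u ∉ coreVertices H, c u ≤ 0) ∧
      (∀ u ∉ coreVertices H, c u = 0 →
        (H.degree u = 1 ∧ ∃ v, H.Adj u v ∧ 3 ≤ H.degree v) ∨ (H.degree u = 2 ∧ x u = 1) ∨
        (3 ≤ H.degree u ∧ (∃ l, H.Adj u l ∧ H.degree l = 1) ∧
          ∃ v w, v ≠ w ∧ H.Adj u v ∧ H.Adj u w ∧ H.degree v ≠ 1 ∧ H.degree w ≠ 1)) := by
  set t : V → V → ℝ := fun u v =>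
    if H.Adj u v ∧ 3 ≤ H.degree u ∧ H.degree v = 1 then 1 / 2 else 0 with ht
  set L : V → Finset V := fun u => (H.neighborFinset u).filter (fun v => H.degree v = 1) with hL
  have hout_small : ∀ u, H.degree u < 3 → ∑ v ∈ U, t u v = 0 := by
    intro u hu
    refine Finset.sum_eq_zero fun v _ => if_neg ?_
    rintro ⟨-, h, -⟩
    omega
  have hout : ∀ u, 3 ≤ H.degree u → ∑ v ∈ U, t u v = ((L u).card : ℝ) / 2 := by
    intro u hu
    have : U.filter (fun v => H.Adj u v ∧ 3 ≤ H.degree u ∧ H.degree v = 1) = L u := by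
      ext v
      simp only [hL, Finset.mem_filter, mem_neighborFinset]
      constructor
      · rintro ⟨-, h1, -, h2⟩
        exact ⟨h1, h2⟩
      · rintro ⟨h1, h2⟩
        exact ⟨hU v u h1.symm, h1, hu, h2⟩
    simp only [ht]
    rw [← Finset.sum_filter, this, Finset.sum_const, nsmul_eq_mul]
    ring
  have hin_zero : ∀ u, H.degree u ≠ 1 → ∑ v ∈ U, t v u = 0 := by
    intro u hu
    refine Finset.sum_eq_zero fun v _ => if_neg ?_
    rintro ⟨-, -, h⟩
    exact hu h
  have hin_one : ∀ u, H.degree u = 1 → ∃ w, H.Adj u w ∧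
      ∑ v ∈ U, t v u = if 3 ≤ H.degree w then 1 / 2 else 0 := by
    intro u hu
    obtain ⟨w, hw⟩ := (H.degree_pos_iff_exists_adj u).1 (by omega)
    refine ⟨w, hw, ?_⟩
    rw [Finset.sum_eq_single w]
    · simp [ht, hw.symm, hu]
    · intro v _ hvw
      refine if_neg ?_
      rintro ⟨h, -, -⟩
      exact hvw (eq_of_adj_of_degree_eq_one hu h.symm hw)
    · intro h
      exact absurd (hU w u hw.symm) h
  have hsplit : ∀ u, (L u).card +
      ((H.neighborFinset u).filter (fun v => H.degree v ≠ 1)).card = H.degree u := by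
    intro u
    rw [← H.card_neighborFinset_eq_degree, hL]
    exact Finset.card_filter_add_card_filter_not _
  have hL_core : ∀ u ∈ coreVertices H, (L u).card = 0 := by
    intro u hu
    rw [Finset.card_eq_zero, hL]
    refine Finset.filter_eq_empty_iff.2 fun v hv => ?_
    exact (Finset.mem_filter.1 hu).2.2 v (by simpa using hv)
  have hL_pos : ∀ u ∉ coreVertices H, 3 ≤ H.degree u →
      0 < (L u).card ∧ H.degree u ≤ (L u).card + 2 := by
    intro u hu h3
    rcases h3.eq_or_lt with h | h
    · have hpos : 0 < (L u).card := by
        rw [Finset.card_pos]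
        by_contra hne
        refine hu (Finset.mem_filter.2 ⟨Finset.mem_univ _, h.symm, fun v hv hv1 => hne ?_⟩)
        exact ⟨v, Finset.mem_filter.2 ⟨by simpa using hv, hv1⟩⟩
      exact ⟨hpos, by omega⟩
    · have := hH.card_filter_degree_ne_one_le (a := u) (by omega)
      have := hsplit u
      omega
  have hcase : ∀ u ∉ coreVertices H, 3 ≤ H.degree u →
      ((H.degree u : ℝ) - 1) * x u - (H.degree u : ℝ) / 2 - ((L u).card : ℝ) / 2 ≤
        ((H.degree u : ℝ) - 2 - (L u).card) / 2 := by
    intro u _ h3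
    have h3' : (3 : ℝ) ≤ H.degree u := by exact_mod_cast h3
    nlinarith [hx1 u]
  refine ⟨fun u => ((H.degree u : ℝ) - 1) * x u - (H.degree u : ℝ) / 2 +
    ∑ v ∈ U, t v u - ∑ v ∈ U, t u v, ?_, ?_, ?_, ?_⟩
  · have hswap : ∑ u ∈ U, ∑ v ∈ U, t v u = ∑ u ∈ U, ∑ v ∈ U, t u v := Finset.sum_comm
    rw [Finset.sum_sub_distrib (g := fun u => ∑ v ∈ U, t u v),
      Finset.sum_add_distrib (g := fun u => ∑ v ∈ U, t v u), hswap, add_sub_cancel_right]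
  · intro u hu
    have h3 := (Finset.mem_filter.1 hu).2.1
    beta_reduce
    rw [hin_zero u (by omega), hout u h3.ge, hL_core u hu, h3]
    push_cast
    ring
  · intro u hu
    beta_reduce
    have hxu := hx1 u
    have hxp := hx0 u
    obtain h | h | h | h : H.degree u = 0 ∨ H.degree u = 1 ∨ H.degree u = 2 ∨ 3 ≤ H.degree u := by
      omega
    · rw [hin_zero u (by omega), hout_small u (by omega), h]
      norm_num
      exact hxp.le
    · obtain ⟨w, -, hw⟩ := hin_one u h
      rw [hw, hout_small u (by omega), h]
      split_ifs <;> norm_num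
    · rw [hin_zero u (by omega), hout_small u (by omega), h]
      norm_num
      linarith
    · rw [hin_zero u (by omega), hout u h]
      have h1 := hcase u hu h
      have h2 : (H.degree u : ℝ) ≤ (L u).card + 2 := by exact_mod_cast (hL_pos u hu h).2
      linarith
  · intro u hu
    beta_reduce
    intro hc
    have hxu := hx1 u
    have hxp := hx0 u
    obtain h | h | h | h : H.degree u = 0 ∨ H.degree u = 1 ∨ H.degree u = 2 ∨ 3 ≤ H.degree u := by
      omega
    · rw [hin_zero u (by omega), hout_small u (by omega), h] at hc
      norm_num at hc
      linarith
    · obtain ⟨w, huw, hw⟩ := hin_one u h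
      rw [hw, hout_small u (by omega), h] at hc
      refine Or.inl ⟨h, w, huw, ?_⟩
      by_contra h3
      rw [if_neg h3] at hc
      norm_num at hc
    · rw [hin_zero u (by omega), hout_small u (by omega), h] at hc
      refine Or.inr (Or.inl ⟨h, ?_⟩)
      norm_num at hc
      linarith
    · rw [hin_zero u (by omega), hout u h] at hc
      have h1 := hcase u hu h
      have h2 : ((L u).card : ℝ) + 2 ≤ H.degree u := by linarith
      have h2' : (L u).card + 2 ≤ H.degree u := by exact_mod_cast h2
      refine Or.inr (Or.inr ⟨h, ?_, ?_⟩)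
      · obtain ⟨l, hl⟩ := Finset.card_pos.1 (hL_pos u hu h).1
        rw [hL, Finset.mem_filter, mem_neighborFinset] at hl
        exact ⟨l, hl⟩
      · have h4 := hsplit u
        obtain ⟨v, w, hv, hw, hvw⟩ := Finset.one_lt_card_iff.1
          (show 1 < ((H.neighborFinset u).filter (fun v => H.degree v ≠ 1)).card by omega)
        simp only [Finset.mem_filter, mem_neighborFinset] at hv hw
        exact ⟨v, w, hvw, hv.1, hw.1, hv.2, hw.2⟩

theorem NoPathFive.sum_le_card_coreVertices {V : Type*} [Fintype V] [DecidableEq V]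
    {H : SimpleGraph V} [DecidableRel H.Adj] (hH : NoPathFive H) {x : V → ℝ}
    (hx0 : ∀ v, 0 < x v) (hx1 : ∀ v, x v ≤ 1) {U : Finset V} (hU : ∀ u v, H.Adj u v → u ∈ U)
    (hcore : coreVertices H ⊆ U) :
    ∑ u ∈ U, (((H.degree u : ℝ) - 1) * x u - (H.degree u : ℝ) / 2) ≤
      ((coreVertices H).card : ℝ) / 2 := by
  obtain ⟨c, hc, hc1, hc2, -⟩ := hH.exists_discharge hx0 hx1 hU
  rw [hc, ← Finset.sum_sdiff hcore]
  have h1 : ∑ u ∈ U \ coreVertices H, c u ≤ 0 :=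
    Finset.sum_nonpos fun u hu => hc2 u (Finset.mem_sdiff.1 hu).2
  have h2 : ∑ u ∈ coreVertices H, c u ≤ ∑ u ∈ coreVertices H, (1 / 2 : ℝ) := by
    refine Finset.sum_le_sum fun u hu => ?_
    rw [hc1 u hu]
    linarith [hx1 u]
  rw [Finset.sum_const, nsmul_eq_mul] at h2
  linarith

theorem NoPathFive.sum_coreVertices_neg {V : Type*} [Fintype V] [DecidableEq V]
    {H : SimpleGraph V} [DecidableRel H.Adj] (hH : NoPathFive H) {x : V → ℝ}
    (hpair : ∀ a ∈ coreVertices H, ∀ b ∈ coreVertices H, b ≠ a →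
      insert a (H.neighborFinset a) = insert b (H.neighborFinset b) → x a + x b < 3 / 2)
    (hne : (coreVertices H).Nonempty) :
    ∑ u ∈ coreVertices H, (x u - 3 / 4) < 0 := by
  choose! f hfB hfne hfN using fun a (ha : a ∈ coreVertices H) => hH.exists_twin ha
  set B := coreVertices H
  set P := B.filter (fun a => 3 / 4 ≤ x a)
  have hPB : P ⊆ B := Finset.filter_subset _ _
  rcases P.eq_empty_or_nonempty with hP | hP
  · refine Finset.sum_neg (fun u hu => ?_) hne
    have := Finset.filter_eq_empty_iff.1 hP hu
    linarith
  have hinj : Set.InjOn f P := by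
    intro a ha b hb hab
    by_contra hne
    have ha' := Finset.mem_filter.1 ha
    have hb' := Finset.mem_filter.1 hb
    have := hpair a ha'.1 b hb'.1 (Ne.symm hne) (by rw [hfN a ha'.1, hab, hfN b hb'.1])
    linarith
  have hpr : ∀ a ∈ P, x a + x (f a) < 3 / 2 := fun a ha =>
    hpair a (hPB ha) (f a) (hfB a (hPB ha)) (hfne a (hPB ha)) (hfN a (hPB ha))
  have hsub : P.image f ⊆ B \ P := by
    intro b hb
    obtain ⟨a, ha, rfl⟩ := Finset.mem_image.1 hb
    refine Finset.mem_sdiff.2 ⟨hfB a (hPB ha), fun h => ?_⟩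
    have := hpr a ha
    linarith [(Finset.mem_filter.1 ha).2, (Finset.mem_filter.1 h).2]
  have h1 : ∑ u ∈ B \ P, (x u - 3 / 4) ≤ ∑ u ∈ P.image f, (x u - 3 / 4) := by
    rw [← Finset.sum_sdiff hsub]
    refine add_le_of_nonpos_left (Finset.sum_nonpos fun u hu => ?_)
    have hu' := Finset.mem_sdiff.1 (Finset.mem_sdiff.1 hu).1
    have : ¬ (3 / 4 ≤ x u) := fun h => hu'.2 (Finset.mem_filter.2 ⟨hu'.1, h⟩)
    linarith
  rw [Finset.sum_image hinj] at h1
  have h2 : ∑ a ∈ P, ((x (f a) - 3 / 4) + (x a - 3 / 4)) < 0 :=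
    Finset.sum_neg (fun a ha => by linarith [hpr a ha]) hP
  rw [Finset.sum_add_distrib] at h2
  rw [← Finset.sum_sdiff hPB]
  linarith

/-- If twin core vertices have small weights, the total is nonpositive, and it vanishes only
in the presence of a vertex of degree two and weight one. -/
theorem NoPathFive.sum_nonpos {V : Type*} [Fintype V] [DecidableEq V]
    {H : SimpleGraph V} [DecidableRel H.Adj] (hH : NoPathFive H) {x : V → ℝ}
    (hx0 : ∀ v, 0 < x v) (hx1 : ∀ v, x v ≤ 1) {U : Finset V} (hU : ∀ u v, H.Adj u v → u ∈ U)
    (hcore : coreVertices H ⊆ U) (hUne : U.Nonempty)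
    (hpair : ∀ a ∈ coreVertices H, ∀ b ∈ coreVertices H, b ≠ a →
      insert a (H.neighborFinset a) = insert b (H.neighborFinset b) → x a + x b < 3 / 2) :
    ∑ u ∈ U, (((H.degree u : ℝ) - 1) * x u - (H.degree u : ℝ) / 2) ≤ 0 ∧
    (∑ u ∈ U, (((H.degree u : ℝ) - 1) * x u - (H.degree u : ℝ) / 2) = 0 →
      ∃ p ∈ U, H.degree p = 2 ∧ x p = 1) := by
  obtain ⟨c, hc, hc1, hc2, hc3⟩ := hH.exists_discharge hx0 hx1 hU
  rw [hc, ← Finset.sum_sdiff hcore]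
  have h1 : ∑ u ∈ U \ coreVertices H, c u ≤ 0 :=
    Finset.sum_nonpos fun u hu => hc2 u (Finset.mem_sdiff.1 hu).2
  have h2 : ∑ u ∈ coreVertices H, c u = 2 * ∑ u ∈ coreVertices H, (x u - 3 / 4) := by
    rw [Finset.mul_sum]
    exact Finset.sum_congr rfl hc1
  rcases (coreVertices H).eq_empty_or_nonempty with hB | hB
  swap
  · have := hH.sum_coreVertices_neg hpair hB
    constructor <;> intros <;> linarith
  simp only [hB, Finset.sum_empty, Finset.sdiff_empty, add_zero] at h1 ⊢
  refine ⟨h1, fun h0 => ?_⟩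
  have hnB : ∀ u, u ∉ coreVertices H := by simp [hB]
  have hzero : ∀ u ∈ U, c u = 0 :=
    (Finset.sum_eq_zero_iff_of_nonpos fun u _ => hc2 u (hnB u)).1 h0
  by_contra! hcon
  have hbig : ∀ u, 3 ≤ H.degree u → (∃ l, H.Adj u l ∧ H.degree l = 1) ∧
      ∃ v w, v ≠ w ∧ H.Adj u v ∧ H.Adj u w ∧ H.degree v ≠ 1 ∧ H.degree w ≠ 1 := by
    intro u hu
    obtain ⟨v, hv⟩ := (H.degree_pos_iff_exists_adj u).1 (by omega)
    rcases hc3 u (hnB u) (hzero u (hU u v hv)) with h | h | h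
    · omega
    · omega
    · exact h.2
  have hleaf : ∀ u v, H.Adj u v → H.degree v ≠ 1 → ∃ l, H.Adj v l ∧ H.degree l = 1 := by
    intro u v huv hv
    have hvU := hU v u huv.symm
    rcases hc3 v (hnB v) (hzero v hvU) with h | h | h
    · exact absurd h.1 hv
    · exact absurd h.2 (hcon v hvU h.1)
    · exact h.2.1
  obtain ⟨u, hu⟩ : ∃ u, 3 ≤ H.degree u := by
    obtain ⟨u, hu⟩ := hUne
    rcases hc3 u (hnB u) (hzero u hu) with h | h | h
    · exact ⟨h.2.choose, h.2.choose_spec.2⟩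
    · exact absurd h.2 (hcon u hu h.1)
    · exact ⟨u, h.1⟩
  obtain ⟨-, v, w, hvw, hv, hw, hdv, hdw⟩ := hbig u hu
  obtain ⟨k, hk, hdk⟩ := hleaf u v hv hdv
  obtain ⟨l, hl, hdl⟩ := hleaf u w hw hdw
  have hku : k ≠ u := by rintro rfl; omega
  have hlu : l ≠ u := by rintro rfl; omega
  have hkw : k ≠ w := by rintro rfl; exact hdw hdk
  have hlv : l ≠ v := by rintro rfl; exact hdv hdl
  have hkl : k ≠ l := by
    rintro rfl
    exact hvw (eq_of_adj_of_degree_eq_one hdk hk.symm hl.symm)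
  exact hH hk.symm hv.symm hw hl hku hkw hkl hvw hlv.symm hlu.symm

/-- The graph formed by the edges of `G` inside the neighborhood of `o`. -/
def linkGraph {V : Type*} (G : SimpleGraph V) (o : V) : SimpleGraph V where
  Adj u v := G.Adj u v ∧ G.Adj o u ∧ G.Adj o v
  symm := ⟨fun _ _ h => ⟨h.1.symm, h.2.2, h.2.1⟩⟩
  loopless := ⟨fun _ h => h.1.ne rfl⟩

theorem F6Free.noPathFive_linkGraph {V : Type*} {G : SimpleGraph V} (hG : F6Free G) (o : V) :
    NoPathFive (linkGraph G o) := fun _ _ _ _ _ h1 h2 h3 h4 h13 h14 h15 h24 h25 h35 =>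
  hG.not_fan h1.2.1 h2.2.1 h3.2.1 h4.2.1 h4.2.2 h1.1 h2.1 h3.1 h4.1 h13 h14 h15 h24 h25 h35

/-- In a graph with no path on five vertices, twin core vertices `a` and `b` have exactly two
common neighbors `c` and `d`, and the component containing them is `{a, b, c, d}`. -/
theorem NoPathFive.exists_common_neighbors {V : Type*} [Fintype V] [DecidableEq V]
    {H : SimpleGraph V} [DecidableRel H.Adj] (hH : NoPathFive H) {a b : V}
    (ha : a ∈ coreVertices H) (hba : b ≠ a)
    (hN : insert a (H.neighborFinset a) = insert b (H.neighborFinset b)) :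
    ∃ c d, c ≠ d ∧ a ≠ c ∧ a ≠ d ∧ b ≠ c ∧ b ≠ d ∧
      H.neighborFinset a = {b, c, d} ∧ H.neighborFinset b = {a, c, d} ∧
      H.neighborFinset c ⊆ {a, b, d} ∧ H.neighborFinset d ⊆ {a, b, c} := by
  have hab : b ∈ H.neighborFinset a := by
    have : b ∈ insert a (H.neighborFinset a) := by rw [hN]; exact Finset.mem_insert_self _ _
    exact (Finset.mem_insert.1 this).resolve_left hba
  have hcard : ((H.neighborFinset a).erase b).card = 2 := by
    rw [Finset.card_erase_of_mem hab, H.card_neighborFinset_eq_degree,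
      (Finset.mem_filter.1 ha).2.1]
  obtain ⟨c, d, hcd, hE⟩ := Finset.card_eq_two.1 hcard
  have hNa : H.neighborFinset a = {b, c, d} := by rw [← Finset.insert_erase hab, hE]
  have hadj : ∀ t, H.Adj a t ↔ t = b ∨ t = c ∨ t = d := by
    intro t
    rw [← mem_neighborFinset, hNa]
    simp
  have hc : c ∈ (H.neighborFinset a).erase b := by rw [hE]; simp
  have hd : d ∈ (H.neighborFinset a).erase b := by rw [hE]; simp
  have hac : H.Adj a c := (hadj c).2 (by simp)
  have had : H.Adj a d := (hadj d).2 (by simp)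
  have hab' : H.Adj a b := (hadj b).2 (by simp)
  have hcb : c ≠ b := Finset.ne_of_mem_erase hc
  have hdb : d ≠ b := Finset.ne_of_mem_erase hd
  have hNb : H.neighborFinset b = {a, c, d} := by
    have h1 : H.neighborFinset b = (insert b (H.neighborFinset b)).erase b := by
      rw [Finset.erase_insert (by simp)]
    rw [h1, ← hN, hNa]
    ext t
    simp only [Finset.mem_erase, Finset.mem_insert, Finset.mem_singleton]
    constructor
    · tauto
    · rintro (rfl | rfl | rfl)
      · exact ⟨hba.symm, Or.inl rfl⟩
      · exact ⟨hcb, by tauto⟩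
      · exact ⟨hdb, by tauto⟩
  have hbc : H.Adj b c := by rw [← mem_neighborFinset, hNb]; simp
  have hbd : H.Adj b d := by rw [← mem_neighborFinset, hNb]; simp
  have key : ∀ c d, c ≠ d → H.Adj a c → H.Adj a d → H.Adj b c → H.Adj b d →
      H.neighborFinset c ⊆ {a, b, d} := by
    intro c d hcd hac had hbc hbd t ht
    rw [mem_neighborFinset] at ht
    simp only [Finset.mem_insert, Finset.mem_singleton]
    by_contra! hcon
    exact hH ht.symm hac.symm hab' hbd hcon.1 hcon.2.1 hcon.2.2 hbc.ne' hcd had.ne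
  exact ⟨c, d, hcd, hac.ne, had.ne, hbc.ne, hbd.ne, hNa, hNb, key c d hcd hac had hbc hbd,
    key d c hcd.symm had hac hbd hbc⟩

lemma ite_add_ite_add_ite_le_one {p q r : Prop} [Decidable p] [Decidable q] [Decidable r]
    (hpq : p → q → False) (hpr : p → r → False) (hqr : q → r → False) :
    (if p then (1 : ℝ) else 0) + (if q then 1 else 0) + (if r then 1 else 0) ≤ 1 := by
  by_cases hp : p <;> by_cases hq : q <;> by_cases hr : r <;> simp_all

set_option maxHeartbeats 1000000 in
/-- If `G` is `F₆`-free with `m` edges, `x` is a positive eigenvector for an eigenvalue `lam ≥ 9`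
with `lam ^ 2 - lam ≥ m - 1`, and `x` attains its maximum `1` at `o`, then no edge of `G` joins
two vertices outside the closed neighborhood of `o`. -/
theorem F6Free.not_adj_of_dominant {V : Type*} [Fintype V] [DecidableEq V] {G : SimpleGraph V}
    [DecidableRel G.Adj] (hG : F6Free G) {m lam : ℝ} (hm : ∑ v, (G.degree v : ℝ) = 2 * m)
    (hlam : m - 1 ≤ lam ^ 2 - lam) (hlam9 : 9 ≤ lam) {x : V → ℝ} (hx0 : ∀ v, 0 < x v)
    (hx1 : ∀ v, x v ≤ 1) {o : V} (ho : x o = 1)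
    (heig : ∀ v, lam * x v = ∑ u ∈ G.neighborFinset v, x u) {w₁ w₂ : V}
    (hw₁ : w₁ ≠ o ∧ ¬ G.Adj o w₁) (hw₂ : w₂ ≠ o ∧ ¬ G.Adj o w₂) : ¬ G.Adj w₁ w₂ := by
  intro hw
  set U := G.neighborFinset o with hU
  set W : Finset V := Finset.univ.filter (fun v => v ≠ o ∧ ¬ G.Adj o v) with hW
  set A : V → V → ℝ := fun u v => if G.Adj u v then 1 else 0 with hA
  have hAsymm : ∀ u v, A u v = A v u := fun u v => by simp only [hA, G.adj_comm]
  have hA0 : ∀ u v, 0 ≤ A u v := fun u v => by simp only [hA]; split_ifs <;> norm_num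
  have hA1 : ∀ u v, A u v ≤ 1 := fun u v => by simp only [hA]; split_ifs <;> norm_num
  have hAadj : ∀ {u v}, G.Adj u v → A u v = 1 := fun h => if_pos h
  have hAnadj : ∀ {u v}, ¬ G.Adj u v → A u v = 0 := fun h => if_neg h
  have hmU : ∀ {u}, u ∈ U ↔ G.Adj o u := by intro u; simp [hU]
  have hmW : ∀ {u}, u ∈ W ↔ u ≠ o ∧ ¬ G.Adj o u := by intro u; simp [hW]
  have hsplit : ∀ f : V → ℝ, ∑ v, f v = f o + ∑ u ∈ U, f u + ∑ w ∈ W, f w := by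
    intro f
    have h1 : Finset.univ = insert o (U ∪ W) := by
      ext v
      simp only [Finset.mem_univ, Finset.mem_insert, Finset.mem_union, hmU, hmW, true_iff]
      tauto
    have h2 : Disjoint U W := by
      rw [Finset.disjoint_left]
      intro v hv hv'
      exact (hmW.1 hv').2 (hmU.1 hv)
    have h3 : o ∉ U ∪ W := by simp [hmU, hmW]
    rw [h1, Finset.sum_insert h3, Finset.sum_union h2]
    ring
  have hnb : ∀ (v : V) (f : V → ℝ), ∑ u ∈ G.neighborFinset v, f u = ∑ u, A v u * f u := by
    intro v f
    simp only [hA, ite_mul, one_mul, zero_mul]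
    rw [← Finset.sum_filter]
    congr 1
    ext u
    simp
  have heig' : ∀ v, lam * x v = A v o + ∑ u ∈ U, A v u * x u + ∑ w ∈ W, A v w * x w := by
    intro v
    rw [heig, hnb, hsplit, ho, mul_one]
  have hdeg : ∀ v, (G.degree v : ℝ) = A v o + ∑ u ∈ U, A v u + ∑ w ∈ W, A v w := by
    intro v
    have := hnb v (fun _ => 1)
    rw [hsplit] at this
    simpa using this
  have hUx : ∑ u ∈ U, x u = lam := by rw [← heig, ho, mul_one]
  have heU : ∀ u ∈ U, lam * x u = 1 + ∑ v ∈ U, A u v * x v + ∑ w ∈ W, A u w * x w := by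
    intro u hu
    rw [heig', hAadj (hmU.1 hu).symm]
  have heW : ∀ w ∈ W, lam * x w = ∑ v ∈ U, A w v * x v + ∑ v ∈ W, A w v * x v := by
    intro w hw
    rw [heig', hAnadj (fun h => (hmW.1 hw).2 h.symm), zero_add]
  set H := linkGraph G o with hHdef
  have hP : NoPathFive H := hG.noPathFive_linkGraph o
  have hHadj : ∀ {u v}, H.Adj u v ↔ G.Adj u v ∧ G.Adj o u ∧ G.Adj o v := Iff.rfl
  have hHU : ∀ u v, H.Adj u v → u ∈ U := fun u v h => hmU.2 h.2.1
  have hHnb : ∀ u ∈ U, ∀ f : V → ℝ, ∑ v ∈ U, A u v * f v = ∑ v ∈ H.neighborFinset u, f v := by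
    intro u hu f
    simp only [hA, ite_mul, one_mul, zero_mul]
    rw [← Finset.sum_filter]
    congr 1
    ext v
    simp only [Finset.mem_filter, mem_neighborFinset, hHadj, hmU]
    have := hmU.1 hu
    tauto
  have hHdeg : ∀ u ∈ U, (H.degree u : ℝ) = ∑ v ∈ U, A u v := by
    intro u hu
    have := hHnb u hu (fun _ => 1)
    simpa using this.symm
  have hcore : coreVertices H ⊆ U := by
    intro u hu
    have h3 := (Finset.mem_filter.1 hu).2.1
    obtain ⟨v, hv⟩ := (H.degree_pos_iff_exists_adj u).1 (by omega)
    exact hHU u v hv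
  set DU := ∑ u ∈ U, ∑ v ∈ U, A u v with hDU
  set E := ∑ w ∈ W, ∑ u ∈ U, A w u with hE
  set DW := ∑ w ∈ W, ∑ v ∈ W, A w v with hDW
  have hE' : ∑ u ∈ U, ∑ w ∈ W, A u w = E := by
    rw [Finset.sum_comm]
    refine Finset.sum_congr rfl fun w _ => Finset.sum_congr rfl fun u _ => hAsymm _ _
  have hcardU : lam ≤ (U.card : ℝ) := by
    rw [← hUx, Finset.card_eq_sum_ones]
    push_cast
    exact Finset.sum_le_sum fun u _ => hx1 u
  have hmsum : 2 * m = 2 * (U.card : ℝ) + DU + 2 * E + DW := by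
    rw [← hm, hsplit]
    have h1 : (G.degree o : ℝ) = U.card := by rw [hU, G.card_neighborFinset_eq_degree]
    have h2 : ∑ u ∈ U, (G.degree u : ℝ) = U.card + DU + E := by
      rw [← hE', hDU, Finset.sum_congr rfl fun u hu => by
        rw [hdeg u, hAadj (hmU.1 hu).symm], Finset.sum_add_distrib, Finset.sum_add_distrib]
      simp
    have h3 : ∑ w ∈ W, (G.degree w : ℝ) = E + DW := by
      rw [hE, hDW, Finset.sum_congr rfl fun w hw => by
        rw [hdeg w, hAnadj (fun h => (hmW.1 hw).2 h.symm), zero_add], Finset.sum_add_distrib]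
    rw [h1, h2, h3]
    ring
  have hlamsq : lam ^ 2 = U.card + ∑ u ∈ U, (H.degree u : ℝ) * x u +
      ∑ w ∈ W, (∑ u ∈ U, A w u) * x w := by
    have h1 : lam ^ 2 = ∑ u ∈ U, lam * x u := by rw [← Finset.mul_sum, hUx]; ring
    rw [h1, Finset.sum_congr rfl heU, Finset.sum_add_distrib, Finset.sum_add_distrib,
      Finset.sum_comm (s := U) (t := U), Finset.sum_comm (s := U) (t := W)]
    congr 1
    · congr 1
      · simp
      · refine Finset.sum_congr rfl fun u hu => ?_
        rw [hHdeg u hu, Finset.sum_mul]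
        exact Finset.sum_congr rfl fun v _ => by rw [hAsymm]
    · refine Finset.sum_congr rfl fun w _ => ?_
      rw [Finset.sum_mul]
      exact Finset.sum_congr rfl fun u _ => by rw [hAsymm]
  set S := ∑ u ∈ U, (((H.degree u : ℝ) - 1) * x u - (H.degree u : ℝ) / 2) with hS
  have hSeq : S = ∑ u ∈ U, (H.degree u : ℝ) * x u - lam - DU / 2 := by
    have h1 : DU = ∑ u ∈ U, (H.degree u : ℝ) := Finset.sum_congr rfl fun u hu => (hHdeg u hu).symm
    rw [hS, h1, ← hUx, Finset.sum_div, ← Finset.sum_sub_distrib, ← Finset.sum_sub_distrib]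
    exact Finset.sum_congr rfl fun u _ => by ring
  set R := ∑ w ∈ W, (∑ u ∈ U, A w u) * (1 - x w) with hR
  have hReq : R = E - ∑ w ∈ W, (∑ u ∈ U, A w u) * x w := by
    rw [hR, hE, ← Finset.sum_sub_distrib]
    exact Finset.sum_congr rfl fun w _ => by ring
  have hR0' : ∀ w ∈ W, 0 ≤ (∑ u ∈ U, A w u) * (1 - x w) := fun w _ =>
    mul_nonneg (Finset.sum_nonneg fun u _ => hA0 w u) (by linarith [hx1 w])
  have hR0 : 0 ≤ R := Finset.sum_nonneg hR0'
  have hkey : DW / 2 - 1 + R ≤ S := by linarith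
  have hw₁W : w₁ ∈ W := hmW.2 hw₁
  have hw₂W : w₂ ∈ W := hmW.2 hw₂
  have hdW0 : ∀ w, 0 ≤ ∑ v ∈ W, A w v := fun w => Finset.sum_nonneg fun v _ => hA0 w v
  have hdW1 : ∀ w, ∀ v ∈ W, G.Adj w v → 1 ≤ ∑ v ∈ W, A w v := by
    intro w v hv hwv
    rw [← hAadj hwv]
    exact Finset.single_le_sum (f := fun v => A w v) (fun v _ => hA0 w v) hv
  have hDW2 : 2 ≤ DW := by
    have h1 : ∑ w ∈ ({w₁, w₂} : Finset V), ∑ v ∈ W, A w v ≤ DW := by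
      refine Finset.sum_le_sum_of_subset_of_nonneg ?_ fun w _ _ => hdW0 w
      intro v hv
      rcases Finset.mem_insert.1 hv with rfl | hv
      · exact hw₁W
      · rw [Finset.mem_singleton.1 hv]; exact hw₂W
    rw [Finset.sum_pair hw.ne] at h1
    linarith [hdW1 w₁ w₂ hw₂W hw, hdW1 w₂ w₁ hw₁W hw.symm]
  have hXW : lam * ∑ w ∈ W, x w ≤ E + DW := by
    rw [Finset.mul_sum, hE, hDW, ← Finset.sum_add_distrib]
    refine Finset.sum_le_sum fun w hw => ?_
    rw [heW w hw]
    refine add_le_add (Finset.sum_le_sum fun v _ => ?_) (Finset.sum_le_sum fun v _ => ?_)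
    · exact mul_le_of_le_one_right (hA0 w v) (hx1 v)
    · exact mul_le_of_le_one_right (hA0 w v) (hx1 v)
  have hpair : ∀ a ∈ coreVertices H, ∀ b ∈ coreVertices H, b ≠ a →
      insert a (H.neighborFinset a) = insert b (H.neighborFinset b) → x a + x b < 3 / 2 := by
    intro a ha b hb hba hN
    have hB2 : (2 : ℝ) ≤ (coreVertices H).card := by
      have : 1 < (coreVertices H).card := Finset.one_lt_card_iff.2 ⟨b, a, hb, ha, hba⟩
      exact_mod_cast this
    have hSB := hP.sum_le_card_coreVertices hx0 hx1 hHU hcore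
    rw [← hS] at hSB
    have hDUB : 3 * ((coreVertices H).card : ℝ) ≤ DU := by
      have h1 : ∑ u ∈ coreVertices H, (H.degree u : ℝ) ≤ ∑ u ∈ U, (H.degree u : ℝ) :=
        Finset.sum_le_sum_of_subset_of_nonneg hcore fun u _ _ => Nat.cast_nonneg _
      rw [Finset.sum_congr rfl hHdeg, ← hDU, Finset.sum_congr rfl (g := fun _ => (3 : ℝ))
        (fun u hu => by rw [(Finset.mem_filter.1 hu).2.1]; norm_num), Finset.sum_const,
        nsmul_eq_mul] at h1
      linarith
    have hX : ∑ w ∈ W, x w ≤ lam - 2 := by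
      refine le_of_mul_le_mul_left (a := lam) ?_ (by linarith)
      nlinarith
    obtain ⟨c, d, hcd, hac, had, hbc, hbd, hNa, hNb, hNc, hNd⟩ :=
      hP.exists_common_neighbors ha hba hN
    have hab' : H.Adj a b := by rw [← mem_neighborFinset, hNa]; simp
    have hac' : H.Adj a c := by rw [← mem_neighborFinset, hNa]; simp
    have had' : H.Adj a d := by rw [← mem_neighborFinset, hNa]; simp
    have hbc' : H.Adj b c := by rw [← mem_neighborFinset, hNb]; simp
    have hbd' : H.Adj b d := by rw [← mem_neighborFinset, hNb]; simp
    have hdisj₁ : ∀ a b c d w, w ∈ W → c ≠ d → H.Adj a b → H.Adj a c → H.Adj a d → H.Adj b c →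
        H.Adj b d → G.Adj a w → G.Adj b w → False := by
      intro a b c d w hw hcd hab hac had hbc hbd haw hbw
      have hw' := hmW.1 hw
      exact hG.not_fan haw hab.1 hac.1 hab.2.1.symm had.1 hbw.symm hbc.1 hac.2.2.symm had.2.2
        (by rintro rfl; exact hw'.2 hac.2.2) hw'.1 (by rintro rfl; exact hw'.2 had.2.2)
        hab.2.2.ne' hbd.1.ne hcd
    have hdisj₂ : ∀ a b c d w, w ∈ W → c ≠ d → H.Adj a b → H.Adj a c → H.Adj a d → H.Adj b c →
        H.Adj b d → G.Adj a w → G.Adj c w → False := by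
      intro a b c d w hw hcd hab hac had hbc hbd haw hcw
      have hw' := hmW.1 hw
      exact hG.not_fan haw hac.1 hab.1 had.1 hab.2.1.symm hcw.symm hbc.1.symm hbd.1
        had.2.2.symm (by rintro rfl; exact hw'.2 hab.2.2) (by rintro rfl; exact hw'.2 had.2.2)
        hw'.1 hcd hac.2.2.ne' hab.2.2.ne'
    have hWsum : ∀ c d, c ≠ d → H.Adj a c → H.Adj a d → H.Adj b c → H.Adj b d →
        ∑ w ∈ W, A a w * x w + ∑ w ∈ W, A b w * x w + ∑ w ∈ W, A c w * x w ≤ lam - 2 := by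
      intro c d hcd hac had hbc hbd
      refine le_trans ?_ hX
      rw [← Finset.sum_add_distrib, ← Finset.sum_add_distrib]
      refine Finset.sum_le_sum fun w hw => ?_
      have h1 := hdisj₁ a b c d w hw hcd hab' hac had hbc hbd
      have h2 := hdisj₂ a b c d w hw hcd hab' hac had hbc hbd
      have h3 := hdisj₂ b a c d w hw hcd hab'.symm hbc hbd hac had
      have h4 : A a w + A b w + A c w ≤ 1 := ite_add_ite_add_ite_le_one h1 h2 h3
      nlinarith [hx0 w]
    have hW₁ := hWsum c d hcd hac' had' hbc' hbd'
    have hW₂ := hWsum d c hcd.symm had' hac' hbd' hbc'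
    have hWc0 : 0 ≤ ∑ w ∈ W, A c w * x w :=
      Finset.sum_nonneg fun w _ => mul_nonneg (hA0 c w) (hx0 w).le
    have ea := heU a (hmU.2 hab'.2.1)
    have eb := heU b (hmU.2 hab'.2.2)
    have ec := heU c (hmU.2 hac'.2.2)
    have ed := heU d (hmU.2 had'.2.2)
    rw [hHnb a (hmU.2 hab'.2.1), hNa, Finset.sum_insert (by simp [hbc, hbd]),
      Finset.sum_pair hcd] at ea
    rw [hHnb b (hmU.2 hab'.2.2), hNb, Finset.sum_insert (by simp [hac, had]),
      Finset.sum_pair hcd] at eb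
    have hc : ∑ v ∈ H.neighborFinset c, x v ≤ x a + (x b + x d) := by
      rw [← Finset.sum_pair hbd, ← Finset.sum_insert (by simp [hba.symm, had])]
      exact Finset.sum_le_sum_of_subset_of_nonneg hNc fun v _ _ => (hx0 v).le
    have hd : ∑ v ∈ H.neighborFinset d, x v ≤ x a + (x b + x c) := by
      rw [← Finset.sum_pair hbc, ← Finset.sum_insert (by simp [hba.symm, hac])]
      exact Finset.sum_le_sum_of_subset_of_nonneg hNd fun v _ _ => (hx0 v).le
    rw [hHnb c (hmU.2 hac'.2.2)] at ec
    rw [hHnb d (hmU.2 had'.2.2)] at ed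
    have i1 : lam * (x a + x b) ≤ lam + (x a + x b) + 2 * (x c + x d) := by linarith
    have i2 : 2 * (lam * (x a + x b)) + lam * (x c + x d) ≤
        2 + 2 * lam + 4 * (x a + x b) + 5 * (x c + x d) := by linarith
    by_contra! hcon
    have i3 : (lam - 3) / 4 ≤ x c + x d := by nlinarith
    have i4 : (lam - 5) * ((lam - 3) / 4) ≤ (lam - 5) * (x c + x d) :=
      mul_le_mul_of_nonneg_left i3 (by linarith)
    have i5 : (2 * lam - 4) * (3 / 2) ≤ (2 * lam - 4) * (x a + x b) :=
      mul_le_mul_of_nonneg_left hcon (by linarith)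
    nlinarith
  have hUne : U.Nonempty := by
    rw [← Finset.card_pos]
    have : (0 : ℝ) < U.card := by linarith
    exact_mod_cast this
  obtain ⟨hS0, hSp⟩ := hP.sum_nonpos hx0 hx1 hHU hcore hUne hpair
  obtain ⟨p, hpU, hpd, hpx⟩ := hSp (by rw [← hS] at hS0 ⊢; linarith)
  have hDWeq : DW = 2 := by rw [← hS] at hS0; linarith
  have hRz : R = 0 := by rw [← hS] at hS0; linarith
  have hxW : ∀ w ∈ W, (∑ u ∈ U, A w u) * (1 - x w) = 0 :=
    (Finset.sum_eq_zero_iff_of_nonneg hR0').1 hRz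
  have hfull : ∀ w ∈ W, G.Adj p w → (∀ v ∈ W, ¬ G.Adj w v) → ∀ u ∈ U, G.Adj w u := by
    intro w hw hpw hiso u hu
    have h1 : 1 ≤ ∑ u ∈ U, A w u := by
      rw [← hAadj hpw.symm]
      exact Finset.single_le_sum (f := fun v => A w v) (fun v _ => hA0 w v) hpU
    have h2 : x w = 1 := by
      rcases mul_eq_zero.1 (hxW w hw) with h | h <;> linarith
    have h3 := heW w hw
    rw [h2, mul_one, Finset.sum_eq_zero (s := W) (fun v hv => by
      rw [hAnadj (hiso v hv), zero_mul]), add_zero, ← hUx] at h3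
    have h4 := (Finset.sum_eq_sum_iff_of_le (s := U) (f := fun v => A w v * x v) (g := x)
      (fun v _ => mul_le_of_le_one_left (hx0 v).le (hA1 w v))).1 h3.symm u hu
    by_contra h5
    simp only [hAnadj h5, zero_mul] at h4
    exact (hx0 u).ne h4
  obtain ⟨q, r, hqr, hNp⟩ := Finset.card_eq_two.1 ((H.card_neighborFinset_eq_degree p).trans hpd)
  have hpq : H.Adj p q := by rw [← mem_neighborFinset, hNp]; simp
  have hpr : H.Adj p r := by rw [← mem_neighborFinset, hNp]; simp
  set P := W.filter (fun w => G.Adj p w) with hPdef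
  set T := W.filter (fun w => ∃ v ∈ W, G.Adj w v) with hT
  have hPcard : 6 ≤ (P.card : ℝ) := by
    have h1 := heU p hpU
    rw [hHnb p hpU, hNp, Finset.sum_pair hqr, hpx] at h1
    have h2 : ∑ w ∈ W, A p w * x w ≤ P.card := by
      rw [hPdef, Finset.card_filter]
      push_cast
      exact Finset.sum_le_sum fun w _ => mul_le_of_le_one_right (hA0 p w) (hx1 w)
    linarith [hx1 q, hx1 r]
  have hTcard : (T.card : ℝ) ≤ 2 := by
    rw [← hDWeq, hDW, hT, Finset.card_filter]
    push_cast
    refine Finset.sum_le_sum fun w _ => ?_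
    split_ifs with h
    · obtain ⟨v, hv, hwv⟩ := h
      exact hdW1 w v hv hwv
    · exact hdW0 w
  have hcard : 1 < (P \ T).card := by
    have h1 : 6 ≤ P.card := by exact_mod_cast hPcard
    have h2 : T.card ≤ 2 := by exact_mod_cast hTcard
    have h3 := Finset.le_card_sdiff T P
    omega
  obtain ⟨w, w', hwP, hwP', hww'⟩ := Finset.one_lt_card_iff.1 hcard
  have hspec : ∀ w ∈ P \ T, w ∈ W ∧ G.Adj p w ∧ ∀ u ∈ U, G.Adj w u := by
    intro w hw
    obtain ⟨h1, h2⟩ := Finset.mem_sdiff.1 hw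
    obtain ⟨h3, h4⟩ := Finset.mem_filter.1 h1
    refine ⟨h3, h4, hfull w h3 h4 fun v hv hwv => h2 ?_⟩
    exact Finset.mem_filter.2 ⟨h3, v, hv, hwv⟩
  obtain ⟨hwW, hpw, hwU⟩ := hspec w hwP
  obtain ⟨hwW', hpw', hwU'⟩ := hspec w' hwP'
  have hq := hpq.2.2
  have hr := hpr.2.2
  exact hG.not_fan hpw hpq.1 (hmU.1 hpU).symm hpr.1 hpw' (hwU q (hmU.2 hq)) hq.symm hr
    (hwU' r (hmU.2 hr)).symm (hmW.1 hwW).1 (by rintro rfl; exact (hmW.1 hwW).2 hr) hww' hqr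
    (by rintro rfl; exact (hmW.1 hwW').2 hq) (hmW.1 hwW').1.symm

theorem stmt_15 
    {V : Type} [Fintype V] [DecidableEq V] (G : SimpleGraph V) [DecidableRel G.Adj]
    (m : ℕ) (hm : 88 ≤ m)
    (hfree : F6Free G)
    (hcard : G.edgeSet.ncard = m)
    (hnoiso : ∀ v : V, ∃ w, G.Adj v w)
    (hmax : ∀ (n : ℕ) (G' : SimpleGraph (Fin n)), F6Free G' → G'.edgeSet.ncard = m →
      (∀ v, ∃ w, G'.Adj v w) → specRad G' ≤ specRad G)
    (lam : ℝ) (hlam : lam = specRad G)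
    (hconn : G.Connected)
    (hlow : (1 + Real.sqrt (4 * (m : ℝ) - 3)) / 2 ≤ lam)
    (x : V → ℝ) (hxpos : ∀ v, 0 < x v)
    (heig : (G.adjMatrix ℝ).mulVec x = lam • x)
    (ustar : V) (hustar : ∀ v, x v ≤ x ustar)
    :
    eIn G ((insert ustar (G.neighborSet ustar))ᶜ) = 0 := by
  have hx : 0 < x ustar := hxpos ustar
  have hsq : Real.sqrt (4 * (m : ℝ) - 3) ^ 2 = 4 * (m : ℝ) - 3 := by
    refine Real.sq_sqrt ?_
    have : (88 : ℝ) ≤ m := by exact_mod_cast hm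
    linarith
  have hm' : (88 : ℝ) ≤ m := by exact_mod_cast hm
  have hs0 := Real.sqrt_nonneg (4 * (m : ℝ) - 3)
  have hs17 : (17 : ℝ) ≤ Real.sqrt (4 * (m : ℝ) - 3) := Real.le_sqrt_of_sq_le (by linarith)
  have hlam9 : (9 : ℝ) ≤ lam := by linarith
  have hlam2 : (m : ℝ) - 1 ≤ lam ^ 2 - lam := by nlinarith
  have hdeg : ∑ v, (G.degree v : ℝ) = 2 * (m : ℝ) := by
    have h1 := G.sum_degrees_eq_twice_card_edges
    rw [← hcard, ← SimpleGraph.coe_edgeFinset, Set.ncard_coe_finset]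
    exact_mod_cast h1
  have heig' : ∀ v, lam * (x v / x ustar) = ∑ u ∈ G.neighborFinset v, x u / x ustar := by
    intro v
    have h1 := congrFun heig v
    rw [SimpleGraph.adjMatrix_mulVec_apply] at h1
    rw [← Finset.sum_div, h1, Pi.smul_apply, smul_eq_mul, mul_div_assoc]
  have hempty : {e ∈ G.edgeSet | ∀ v ∈ e, v ∈ (insert ustar (G.neighborSet ustar))ᶜ} = ∅ := by
    ext e
    induction e with | _ v w
    simp only [Set.mem_ofPred_eq, SimpleGraph.mem_edgeSet, Sym2.mem_iff, forall_eq_or_imp,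
      forall_eq, Set.mem_compl_iff, Set.mem_insert_iff, SimpleGraph.mem_neighborSet, not_or,
      Set.mem_empty_iff_false, iff_false]
    rintro ⟨hvw, hv, hw⟩
    exact hfree.not_adj_of_dominant hdeg hlam2 hlam9 (x := fun v => x v / x ustar)
      (fun v => div_pos (hxpos v) hx) (fun v => (div_le_one hx).2 (hustar v)) (div_self hx.ne')
      heig' hv hw hvw
  rw [eIn, hempty, Set.ncard_empty]
end

section
/- Under the setup, no component of the induced subgraph G*[U] is isomorphic to the 4-cycle C_4. -/
open SimpleGraph Finset
open scoped Classical

set_option linter.unusedSectionVars false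

section Fan

variable {V : Type*} {G : SimpleGraph V}

/-- An `F₆`-free graph has no path on five vertices inside a neighbourhood. -/
theorem F6Free.no_path_in_neighborhood (h : F6Free G) {o p q r s t : V}
    (hp : G.Adj o p) (hq : G.Adj o q) (hr : G.Adj o r) (hs : G.Adj o s) (ht : G.Adj o t)
    (hpq : G.Adj p q) (hqr : G.Adj q r) (hrs : G.Adj r s) (hst : G.Adj s t)
    (hpr : p ≠ r) (hps : p ≠ s) (hpt : p ≠ t) (hqs : q ≠ s) (hqt : q ≠ t) (hrt : r ≠ t) :
    False := by
  refine h ⟨⟨![p, q, r, s, t, o], ?_⟩, ?_⟩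
  · intro a b hab
    fin_cases a <;> fin_cases b <;> simp [fan6] at hab ⊢ <;>
      first | assumption | (symm; assumption)
  · have h1 := hp.ne; have h2 := hq.ne; have h3 := hr.ne; have h4 := hs.ne; have h5 := ht.ne
    have h6 := hpq.ne; have h7 := hqr.ne; have h8 := hrs.ne; have h9 := hst.ne
    intro a b hab
    fin_cases a <;> fin_cases b <;> simp at hab ⊢ <;> first | exact absurd hab (by assumption) |
      exact absurd hab.symm (by assumption)

/-- A four-cycle `abcd`, possibly with chords. -/
def IsFourCycle (G : SimpleGraph V) (a b c d : V) : Prop :=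
  G.Adj a b ∧ G.Adj b c ∧ G.Adj c d ∧ G.Adj d a ∧ a ≠ c ∧ b ≠ d

/-- A copy of `K₄ - e` in which `a` and `b` are adjacent to all other vertices. -/
def IsDiamond (G : SimpleGraph V) (a b c d : V) : Prop :=
  G.Adj a b ∧ G.Adj a c ∧ G.Adj a d ∧ G.Adj b c ∧ G.Adj b d ∧ c ≠ d

theorem IsFourCycle.rotate {a b c d : V} (h : IsFourCycle G a b c d) :
    IsFourCycle G b c d a :=
  ⟨h.2.1, h.2.2.1, h.2.2.2.1, h.1, h.2.2.2.2.2, h.2.2.2.2.1.symm⟩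

theorem IsDiamond.isFourCycle {a b c d : V} (h : IsDiamond G a b c d) :
    IsFourCycle G a c b d :=
  ⟨h.2.1, h.2.2.2.1.symm, h.2.2.2.2.1, h.2.2.1.symm, h.1.ne, h.2.2.2.2.2⟩

theorem IsFourCycle.mem_of_adj_first (h : F6Free G) {o a b c d e : V}
    (hC : IsFourCycle G a b c d) (ha : G.Adj o a) (hb : G.Adj o b) (hc : G.Adj o c)
    (hd : G.Adj o d) (he : G.Adj o e) (hae : G.Adj a e) : e = b ∨ e = c ∨ e = d := by
  by_contra! hne
  obtain ⟨hab, hbc, hcd, hda, hac, hbd⟩ := hC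
  exact h.no_path_in_neighborhood he ha hb hc hd hae.symm hab hbc hcd hne.1 hne.2.1 hne.2.2 hac
    hda.ne' hbd

/-- A vertex of an `F₆`-free graph inside a neighbourhood with three non-leaf neighbours is the
centre of a diamond. -/
theorem F6Free.exists_isDiamond (h : F6Free G) {o v y₁ y₂ y₃ z₁ z₂ z₃ : V}
    (hv : G.Adj o v) (hy₁ : G.Adj o y₁) (hy₂ : G.Adj o y₂) (hy₃ : G.Adj o y₃)
    (hz₁ : G.Adj o z₁) (hz₂ : G.Adj o z₂) (hz₃ : G.Adj o z₃)
    (hvy₁ : G.Adj v y₁) (hvy₂ : G.Adj v y₂) (hvy₃ : G.Adj v y₃)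
    (hyz₁ : G.Adj y₁ z₁) (hyz₂ : G.Adj y₂ z₂) (hyz₃ : G.Adj y₃ z₃)
    (hzv₁ : z₁ ≠ v) (hzv₂ : z₂ ≠ v) (hzv₃ : z₃ ≠ v)
    (h₁₂ : y₁ ≠ y₂) (h₁₃ : y₁ ≠ y₃) (h₂₃ : y₂ ≠ y₃) :
    ∃ b c d, G.Adj o b ∧ G.Adj o c ∧ G.Adj o d ∧ IsDiamond G v b c d := by
  have key : ∀ p q r s t, G.Adj o p → G.Adj o q → G.Adj o r → G.Adj o s → G.Adj o t →
      G.Adj p q → G.Adj q r → G.Adj r s → G.Adj s t →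
      p = r ∨ p = s ∨ p = t ∨ q = s ∨ q = t ∨ r = t := by
    intro p q r s t hp hq hr hs ht a1 a2 a3 a4
    by_contra! hne
    exact h.no_path_in_neighborhood hp hq hr hs ht a1 a2 a3 a4 hne.1 hne.2.1 hne.2.2.1
      hne.2.2.2.1 hne.2.2.2.2.1 hne.2.2.2.2.2
  have spoke : ∀ {y y' y'' z z' : V}, G.Adj o y → G.Adj o y' → G.Adj o y'' → G.Adj o z →
      G.Adj o z' → G.Adj v y → G.Adj v y' → G.Adj v y'' → G.Adj y z → G.Adj y' z' →
      z ≠ v → z' ≠ v → y ≠ y' → y ≠ y'' → y' ≠ y'' → G.Adj v z := by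
    intro y y' y'' z z' oy oy' oy'' oz oz' vy vy' vy'' yz yz' zv zv' n1 n2 n3
    by_contra hvz
    have e1 : z ≠ y' := fun e => hvz (e ▸ vy')
    have e2 : z ≠ y'' := fun e => hvz (e ▸ vy'')
    have e3 := vy.ne
    have e4 := vy'.ne
    have e5 := vy''.ne
    have e6 := yz.ne
    rcases key z y v y' z' oz oy hv oy' oz' yz.symm vy.symm vy' yz' with e | e | e | e | e | e
    · exact zv e
    · exact e1 e
    · subst e
      have := key y'' v y z y' oy'' hv oy oz oy' vy''.symm vy yz yz'.symm
      grind
    · exact n1 e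
    · subst e
      have := key y'' v y' y z oy'' hv oy' oy oz vy''.symm vy' yz' yz
      grind
    · exact zv' e.symm
  have vz₁ := spoke hy₁ hy₂ hy₃ hz₁ hz₂ hvy₁ hvy₂ hvy₃ hyz₁ hyz₂ hzv₁ hzv₂ h₁₂ h₁₃ h₂₃
  have vz₂ := spoke hy₂ hy₁ hy₃ hz₂ hz₁ hvy₂ hvy₁ hvy₃ hyz₂ hyz₁ hzv₂ hzv₁ h₁₂.symm h₂₃ h₁₃
  have vz₃ := spoke hy₃ hy₁ hy₂ hz₃ hz₁ hvy₃ hvy₁ hvy₂ hyz₃ hyz₁ hzv₃ hzv₁ h₁₃.symm h₂₃.symm h₁₂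
  have hvne₁ := hvy₁.ne
  have hvne₂ := hvy₂.ne
  have hvne₃ := hvy₃.ne
  by_cases hadj : G.Adj y₁ y₂
  · by_cases e1 : z₃ = y₁
    · exact ⟨y₁, y₂, y₃, hy₁, hy₂, hy₃, hvy₁, hvy₂, hvy₃, hadj, e1 ▸ hyz₃.symm, h₂₃⟩
    by_cases e2 : z₃ = y₂
    · exact ⟨y₂, y₁, y₃, hy₂, hy₁, hy₃, hvy₂, hvy₁, hvy₃, hadj.symm, e2 ▸ hyz₃.symm, h₁₃⟩
    have := key y₁ y₂ v y₃ z₃ hy₁ hy₂ hv hy₃ hz₃ hadj hvy₂.symm hvy₃ hyz₃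
    grind
  · by_cases e : z₁ = z₂
    · exact ⟨z₁, y₁, y₂, hz₁, hy₁, hy₂, vz₁, hvy₁, hvy₂, hyz₁.symm, e ▸ hyz₂.symm, h₁₂⟩
    · have := key z₁ y₁ v y₂ z₂ hz₁ hy₁ hv hy₂ hz₂ hyz₁.symm hvy₁.symm hvy₂ hyz₂
      have e3 : z₁ ≠ y₂ := fun e => hadj (e ▸ hyz₁)
      have e4 : z₂ ≠ y₁ := fun e => hadj (e ▸ hyz₂.symm)
      grind

theorem IsDiamond.not_adj_of_adj_center (h : F6Free G) {o a b c d w : V}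
    (hD : IsDiamond G a b c d) (ha : G.Adj o a) (hb : G.Adj o b) (hc : G.Adj o c)
    (hd : G.Adj o d) (hwo : w ≠ o) (hw : w ∉ ({a, b, c, d} : Set V)) (haw : G.Adj a w) :
    ¬ G.Adj w b ∧ ¬ G.Adj w c ∧ ¬ G.Adj w d := by
  obtain ⟨hab, hac, had, hbc, hbd, hcd⟩ := hD
  simp only [Set.mem_insert_iff, Set.mem_singleton_iff, not_or] at hw
  obtain ⟨wa, wb, wc, wd⟩ := hw
  refine ⟨fun hwb => ?_, fun hwc => ?_, fun hwd => ?_⟩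
  · exact h.no_path_in_neighborhood haw hab hac ha.symm had hwb hbc hc.symm hd wc hwo wd hb.ne'
      hbd.ne hcd
  · exact h.no_path_in_neighborhood haw hac hab had ha.symm hwc hbc.symm hbd hd.symm wb wd hwo hcd
      hc.ne' hb.ne'
  · exact h.no_path_in_neighborhood haw had hab hac ha.symm hwd hbd.symm hbc hc.symm wb wc hwo
      hcd.symm hd.ne' hb.ne'

theorem IsFourCycle.not_adj_of_adj (h : F6Free G) {o a b c d w w' : V}
    (hC : IsFourCycle G a b c d) (ha : G.Adj o a) (hb : G.Adj o b)
    (hd : G.Adj o d) (hwo : w ≠ o) (hwo' : w' ≠ o) (hww : w ≠ w')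
    (hw : w ∉ ({a, b, c, d} : Set V)) (hw' : w' ∉ ({a, b, c, d} : Set V))
    (hwa : G.Adj w a) (hwb : G.Adj w b) (hwa' : G.Adj w' a) : ¬ G.Adj w' d := by
  intro hwd'
  obtain ⟨hab, hbc, hcd, hda, hac, hbd⟩ := hC
  simp only [Set.mem_insert_iff, Set.mem_singleton_iff, not_or] at hw hw'
  exact h.no_path_in_neighborhood hwa.symm hab ha.symm hda.symm hwa'.symm hwb hb.symm hd hwd'.symm
    hwo hw.2.2.2 hww hbd (Ne.symm hw'.2.1) hwo'.symm

end Fan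

section DegIn

variable {V : Type*} (G : SimpleGraph V) [DecidableRel G.Adj]

/-- The number of neighbours of `v` in the finite set `S`. -/
def degIn (S : Finset V) (v : V) : ℕ := #{u ∈ S | G.Adj v u}

theorem sum_degIn_mul (S T : Finset V) (y : V → ℝ) :
    ∑ v ∈ T, ∑ u ∈ S, (if G.Adj v u then y u else 0) = ∑ u ∈ S, (degIn G T u : ℝ) * y u := by
  rw [Finset.sum_comm]
  refine Finset.sum_congr rfl fun u _ => ?_
  simp [degIn, Finset.sum_ite, G.adj_comm]

theorem sum_degIn_comm (S T : Finset V) :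
    ∑ v ∈ T, (degIn G S v : ℝ) = ∑ u ∈ S, (degIn G T u : ℝ) := by
  have := sum_degIn_mul G S T (fun _ => 1)
  simpa [degIn, Finset.sum_ite] using this

theorem degIn_mono {S T : Finset V} (h : S ⊆ T) (v : V) : degIn G S v ≤ degIn G T v :=
  Finset.card_le_card (Finset.filter_subset_filter _ h)

variable {G} [DecidableEq V]

theorem three_le_degIn {w a b c d : V}
    (h : 3 ≤ degIn G {a, b, c, d} w) :
    (G.Adj w a ∧ G.Adj w b ∧ G.Adj w c) ∨ (G.Adj w a ∧ G.Adj w b ∧ G.Adj w d) ∨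
    (G.Adj w a ∧ G.Adj w c ∧ G.Adj w d) ∨ (G.Adj w b ∧ G.Adj w c ∧ G.Adj w d) := by
  have h2 : ∀ p q : V, #({p, q} : Finset V) ≤ 2 := fun p q => Finset.card_le_two
  unfold degIn at h
  by_contra hcon
  have : ∃ p q, ({u ∈ ({a, b, c, d} : Finset V) | G.Adj w u}) ⊆ {p, q} := by
    by_cases h1 : G.Adj w a <;> by_cases h2 : G.Adj w b <;> by_cases h3 : G.Adj w c <;>
      by_cases h4 : G.Adj w d <;> simp_all only [and_self, or_self, and_true, not_true,
        or_true, true_or, and_false]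
    · exact ⟨a, b, by grind⟩
    · exact ⟨a, c, by grind⟩
    · exact ⟨a, d, by grind⟩
    · exact ⟨a, a, by grind⟩
    · exact ⟨b, c, by grind⟩
    · exact ⟨b, d, by grind⟩
    · exact ⟨b, b, by grind⟩
    · exact ⟨c, d, by grind⟩
    · exact ⟨c, c, by grind⟩
    · exact ⟨d, d, by grind⟩
    · exact ⟨d, d, by grind⟩
  obtain ⟨p, q, hpq⟩ := this
  have := Finset.card_le_card hpq
  have := h2 p q
  omega

theorem IsDiamond.degIn_le_two (h : F6Free G) {o a b c d w : V}
    (hD : IsDiamond G a b c d) (ha : G.Adj o a) (hb : G.Adj o b) (hc : G.Adj o c)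
    (hd : G.Adj o d) (hwo : w ≠ o) (how : ¬ G.Adj o w) : degIn G {a, b, c, d} w ≤ 2 := by
  have hw : w ∉ ({a, b, c, d} : Set V) := by
    rintro (rfl | rfl | rfl | rfl) <;> exact how (by assumption)
  have hw' : w ∉ ({b, a, c, d} : Set V) := by rwa [Set.insert_comm]
  have hD' : IsDiamond G b a c d := ⟨hD.1.symm, hD.2.2.2.1, hD.2.2.2.2.1, hD.2.1, hD.2.2.1,
    hD.2.2.2.2.2⟩
  have h1 := hD.not_adj_of_adj_center h ha hb hc hd hwo hw
  have h2 := hD'.not_adj_of_adj_center h hb ha hc hd hwo hw'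
  by_contra! hlt
  have := three_le_degIn hlt
  rw [G.adj_comm] at h1 h2
  tauto

theorem IsFourCycle.degIn_le_two (h : F6Free G) {o a b c d w w' : V}
    (hC : IsFourCycle G a b c d) (ha : G.Adj o a) (hb : G.Adj o b) (hc : G.Adj o c)
    (hd : G.Adj o d) (hwo : w ≠ o) (how : ¬ G.Adj o w) (hwo' : w' ≠ o) (how' : ¬ G.Adj o w')
    (hww : w ≠ w') (hlt : 3 ≤ degIn G {a, b, c, d} w) : degIn G {a, b, c, d} w' ≤ 2 := by
  by_contra! hlt'
  have aux : ∀ a b c d : V, IsFourCycle G a b c d → G.Adj o a → G.Adj o b → G.Adj o c →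
      G.Adj o d → (¬ (G.Adj w a ∧ G.Adj w b ∧ G.Adj w' a ∧ G.Adj w' d)) ∧
        ¬ (G.Adj w' a ∧ G.Adj w' b ∧ G.Adj w a ∧ G.Adj w d) := by
    intro a b c d hC ha hb hc hd
    have hw : w ∉ ({a, b, c, d} : Set V) := by
      rintro (rfl | rfl | rfl | rfl) <;> exact how (by assumption)
    have hw' : w' ∉ ({a, b, c, d} : Set V) := by
      rintro (rfl | rfl | rfl | rfl) <;> exact how' (by assumption)
    exact ⟨fun ⟨h1, h2, h3, h4⟩ =>
        hC.not_adj_of_adj h ha hb hd hwo hwo' hww hw hw' h1 h2 h3 h4,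
      fun ⟨h1, h2, h3, h4⟩ =>
        hC.not_adj_of_adj h ha hb hd hwo' hwo hww.symm hw' hw h1 h2 h3 h4⟩
  have h1 := aux a b c d hC ha hb hc hd
  have h2 := aux b c d a hC.rotate hb hc hd ha
  have h3 := aux c d a b hC.rotate.rotate hc hd ha hb
  have h4 := aux d a b c hC.rotate.rotate.rotate hd ha hb hc
  clear aux
  rcases three_le_degIn hlt with h5 | h5 | h5 | h5 <;>
    rcases three_le_degIn hlt' with h6 | h6 | h6 | h6 <;> grind

end DegIn

section Spectral

variable {V : Type*} [Fintype V] [DecidableEq V] (G : SimpleGraph V) [DecidableRel G.Adj]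

/-- The vertices at distance at least two from `o`. -/
def outer (o : V) : Finset V := {w | w ≠ o ∧ ¬ G.Adj o w}

theorem sum_eq_add_sum_neighborFinset_add_sum_outer (o : V) (g : V → ℝ) :
    ∑ v, g v = g o + ∑ v ∈ G.neighborFinset o, g v + ∑ v ∈ outer G o, g v := by
  have hU : G.neighborFinset o = ({v | v ≠ o} : Finset V).filter (fun v => G.Adj o v) := by
    ext v
    simpa using fun h => G.ne_of_adj h.symm
  have hW : outer G o = ({v | v ≠ o} : Finset V).filter (fun v => ¬ G.Adj o v) := by
    ext v
    simp [outer]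
  rw [hU, hW, add_assoc, Finset.sum_filter_add_sum_filter_not, Finset.filter_ne',
    Finset.add_sum_erase _ _ (Finset.mem_univ o)]

/-- `y` is a nonnegative eigenvector for `lam`, scaled so that its maximum entry is `y o = 1`. -/
structure IsMaxNormalizedEigenvector (lam : ℝ) (y : V → ℝ) (o : V) : Prop where
  eig : ∀ v, lam * y v = ∑ u, if G.Adj v u then y u else 0
  nonneg : ∀ v, 0 ≤ y v
  le_one : ∀ v, y v ≤ 1
  apply_max : y o = 1

variable {G}

theorem two_mul_card_edgeSet (o : V) :
    2 * (G.edgeSet.ncard : ℝ) = 2 * #(G.neighborFinset o)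
      + ∑ u ∈ G.neighborFinset o, (degIn G (G.neighborFinset o) u : ℝ)
      + 2 * ∑ w ∈ outer G o, (degIn G (G.neighborFinset o) w : ℝ)
      + ∑ w ∈ outer G o, (degIn G (outer G o) w : ℝ) := by
  have hdeg : ∀ v, (G.degree v : ℝ) = (if G.Adj v o then 1 else 0)
      + degIn G (G.neighborFinset o) v + degIn G (outer G o) v := by
    intro v
    have := sum_eq_add_sum_neighborFinset_add_sum_outer G o (fun u => if G.Adj v u then 1 else 0)
    rw [← SimpleGraph.card_neighborFinset_eq_degree]
    simpa [degIn, SimpleGraph.neighborFinset_eq_filter] using this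
  have hsum : (∑ v, (G.degree v : ℝ)) = 2 * (G.edgeSet.ncard : ℝ) := by
    rw [Set.ncard_eq_toFinset_card']
    exact_mod_cast G.sum_degrees_eq_twice_card_edges
  rw [← hsum, sum_eq_add_sum_neighborFinset_add_sum_outer G o,
    Finset.sum_congr rfl (fun u _ => hdeg u), Finset.sum_congr rfl (fun u _ => hdeg u)]
  simp only [Finset.sum_add_distrib]
  rw [sum_degIn_comm G (outer G o) (G.neighborFinset o)]
  have h1 : ∑ u ∈ G.neighborFinset o, (if G.Adj u o then (1 : ℝ) else 0)
      = #(G.neighborFinset o) := by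
    rw [Finset.sum_congr rfl (g := fun _ => (1 : ℝ))]
    · simp
    · intro u hu
      rw [G.mem_neighborFinset] at hu
      simp [hu.symm]
  have h2 : ∑ u ∈ outer G o, (if G.Adj u o then (1 : ℝ) else 0) = 0 := by
    refine Finset.sum_eq_zero fun u hu => ?_
    simp only [outer, Finset.mem_filter] at hu
    simp [G.adj_comm u o, hu.2.2]
  rw [h1, h2, ← SimpleGraph.card_neighborFinset_eq_degree]
  ring

namespace IsMaxNormalizedEigenvector

variable {lam : ℝ} {y : V → ℝ} {o : V}

theorem sum_neighborFinset (h : IsMaxNormalizedEigenvector G lam y o) :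
    ∑ u ∈ G.neighborFinset o, y u = lam := by
  have := h.eig o
  rw [h.apply_max, mul_one] at this
  rw [this, SimpleGraph.neighborFinset_eq_filter, Finset.sum_filter]

theorem sq_eq (h : IsMaxNormalizedEigenvector G lam y o) :
    lam ^ 2 = #(G.neighborFinset o)
      + ∑ u ∈ G.neighborFinset o, (degIn G (G.neighborFinset o) u : ℝ) * y u
      + ∑ w ∈ outer G o, (degIn G (G.neighborFinset o) w : ℝ) * y w := by
  have h1 : lam ^ 2 = ∑ u ∈ G.neighborFinset o, ∑ v, if G.Adj u v then y v else 0 := by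
    rw [← Finset.sum_congr rfl (fun u _ => h.eig u), ← Finset.mul_sum, h.sum_neighborFinset]
    ring
  rw [h1, sum_degIn_mul, sum_eq_add_sum_neighborFinset_add_sum_outer G o, h.apply_max, mul_one]
  congr 3
  refine congrArg Finset.card ?_
  refine Finset.filter_true_of_mem fun u hu => ?_
  rwa [G.mem_neighborFinset] at hu

/-- The deficiency inequality behind the spectral bound. -/
theorem sum_outer_le (h : IsMaxNormalizedEigenvector G lam y o)
    (hlam : (G.edgeSet.ncard : ℝ) - 1 ≤ lam ^ 2 - lam) :
    ∑ w ∈ outer G o, ((degIn G (G.neighborFinset o) w : ℝ) * (1 - y w)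
        + (degIn G (outer G o) w : ℝ) / 2) ≤
      1 + ∑ u ∈ G.neighborFinset o, (((degIn G (G.neighborFinset o) u : ℝ) - 1) * y u
        - (degIn G (G.neighborFinset o) u : ℝ) / 2) := by
  have h1 := h.sq_eq
  have h2 := two_mul_card_edgeSet (G := G) o
  have h3 := h.sum_neighborFinset
  simp only [mul_sub, sub_mul, mul_one, one_mul, Finset.sum_add_distrib, Finset.sum_sub_distrib,
    ← Finset.sum_div]
  linarith

theorem sum_nonadj_sub_le (h : IsMaxNormalizedEigenvector G lam y o) {w : V}
    (hw : w ∈ outer G o) :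
    ∑ v ∈ G.neighborFinset o with ¬ G.Adj w v, y v - degIn G (outer G o) w
      ≤ lam * (1 - y w) := by
  have h1 := h.eig w
  rw [sum_eq_add_sum_neighborFinset_add_sum_outer G o] at h1
  simp only [outer, Finset.mem_filter] at hw
  rw [if_neg (fun e => hw.2.2 e.symm), ← Finset.sum_filter, ← Finset.sum_filter] at h1
  have h2 := h.sum_neighborFinset
  rw [← Finset.sum_filter_add_sum_filter_not _ (fun v => G.Adj w v)] at h2
  have h3 : ∑ v ∈ outer G o with G.Adj w v, y v ≤ degIn G (outer G o) w := by
    refine (Finset.sum_le_sum fun v _ => h.le_one v).trans ?_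
    simp [degIn]
  linarith

theorem le_sum_outer_degIn (h : IsMaxNormalizedEigenvector G lam y o) {S : Finset V}
    (hS : S ⊆ G.neighborFinset o)
    (hclosed : ∀ v ∈ S, ∀ u ∈ G.neighborFinset o, G.Adj v u → u ∈ S)
    (hdeg : ∀ v ∈ S, degIn G (G.neighborFinset o) v ≤ 3) :
    (lam - 3) * ∑ v ∈ S, y v - #S ≤ ∑ w ∈ outer G o, (degIn G S w : ℝ) := by
  have h1 : lam * ∑ v ∈ S, y v = #S + ∑ u ∈ G.neighborFinset o, (degIn G S u : ℝ) * y u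
      + ∑ w ∈ outer G o, (degIn G S w : ℝ) * y w := by
    rw [Finset.mul_sum, Finset.sum_congr rfl (fun u _ => h.eig u), sum_degIn_mul,
      sum_eq_add_sum_neighborFinset_add_sum_outer G o, h.apply_max, mul_one]
    congr 3
    refine congrArg Finset.card ?_
    refine Finset.filter_true_of_mem fun u hu => ?_
    have := hS hu
    rwa [G.mem_neighborFinset] at this
  have h2 : ∑ u ∈ G.neighborFinset o, (degIn G S u : ℝ) * y u ≤ 3 * ∑ v ∈ S, y v := by
    rw [Finset.mul_sum, ← Finset.sum_subset hS]
    · refine Finset.sum_le_sum fun v hv => mul_le_mul_of_nonneg_right ?_ (h.nonneg v)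
      exact_mod_cast (degIn_mono G hS v).trans (hdeg v hv)
    · intro u hu huS
      have : degIn G S u = 0 := by
        rw [degIn, Finset.card_eq_zero, Finset.filter_eq_empty_iff]
        exact fun v hv huv => huS (hclosed v hv u hu huv.symm)
      simp [this]
  have h3 : ∑ w ∈ outer G o, (degIn G S w : ℝ) * y w ≤ ∑ w ∈ outer G o, (degIn G S w : ℝ) :=
    Finset.sum_le_sum fun w _ => mul_le_of_le_one_right (Nat.cast_nonneg _) (h.le_one w)
  linarith

end IsMaxNormalizedEigenvector

end Spectral

section Excess

variable {V : Type*} (G : SimpleGraph V) [DecidableRel G.Adj]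

/-- The contribution of `v` to the sum `Σ (d(v) - 1) y(v) - e` over `G[U]`. -/
noncomputable def excess (U : Finset V) (y : V → ℝ) (v : V) : ℝ :=
  ((degIn G U v : ℝ) - 1) * y v - (degIn G U v : ℝ) / 2

/-- The vertices of degree one in `G[U]`. -/
def leaves (U : Finset V) : Finset V := {u ∈ U | degIn G U u = 1}

variable {G}

theorem sum_degIn_leaves (U : Finset V) :
    ∑ v ∈ U, (degIn G (leaves G U) v : ℝ) = ∑ v ∈ U, if degIn G U v = 1 then (1 : ℝ) else 0 := by
  rw [sum_degIn_comm, ← Finset.sum_filter, leaves]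
  refine Finset.sum_congr rfl fun u hu => ?_
  simp [(Finset.mem_filter.1 hu).2]

theorem sum_excess_le [DecidableEq V] {U B : Finset V} {y : V → ℝ} (h0 : ∀ v, 0 ≤ y v)
    (h1 : ∀ v, y v ≤ 1) (hB : B ⊆ U) (hB1 : ∀ v ∈ B, 2 ≤ degIn G U v)
    (hU : ∀ v ∈ U, v ∉ B → degIn G U v ≤ degIn G (leaves G U) v + 2) :
    ∑ v ∈ U, excess G U y v ≤ ∑ v ∈ B, excess G U y v := by
  set g : V → ℝ := fun v => excess G U y v + (if degIn G U v = 1 then (1 : ℝ) else 0) / 2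
    - (degIn G (leaves G U) v : ℝ) / 2 with hg
  have hsum : ∑ v ∈ U, excess G U y v = ∑ v ∈ U, g v := by
    simp only [hg, Finset.sum_sub_distrib, Finset.sum_add_distrib, ← Finset.sum_div]
    rw [sum_degIn_leaves]
    ring
  rw [hsum, ← Finset.sum_sdiff hB]
  have hout : ∑ v ∈ U \ B, g v ≤ 0 := by
    refine Finset.sum_nonpos fun v hv => ?_
    rw [Finset.mem_sdiff] at hv
    have hle := hU v hv.1 hv.2
    have hl : (0 : ℝ) ≤ degIn G (leaves G U) v := Nat.cast_nonneg _
    have hle' : (degIn G U v : ℝ) ≤ degIn G (leaves G U) v + 2 := by exact_mod_cast hle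
    simp only [hg, excess]
    rcases Nat.lt_or_ge (degIn G U v) 2 with hlt | hge
    · interval_cases hd : degIn G U v
      · norm_num
        linarith [h0 v]
      · norm_num
        positivity
    · have hge' : (2 : ℝ) ≤ degIn G U v := by exact_mod_cast hge
      rw [if_neg (by omega)]
      nlinarith [h1 v]
  have hin : ∑ v ∈ B, g v ≤ ∑ v ∈ B, excess G U y v := by
    refine Finset.sum_le_sum fun v hv => ?_
    have := hB1 v hv
    have hl : (0 : ℝ) ≤ degIn G (leaves G U) v := Nat.cast_nonneg _
    simp only [hg]
    rw [if_neg (by omega)]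
    linarith
  linarith

end Excess

section Block

variable {V : Type*} [Fintype V] [DecidableEq V] {G : SimpleGraph V} [DecidableRel G.Adj]

theorem F6Free.degIn_le_degIn_leaves_add_two (h : F6Free G) {o v : V} (hv : G.Adj o v)
    (hcen : ∀ b c d, G.Adj o b → G.Adj o c → G.Adj o d → ¬ IsDiamond G v b c d) :
    degIn G (G.neighborFinset o) v ≤ degIn G (leaves G (G.neighborFinset o)) v + 2 := by
  set U := G.neighborFinset o with hU
  have hmem : ∀ u, u ∈ U ↔ G.Adj o u := fun u => by rw [hU, G.mem_neighborFinset]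
  have hsplit : degIn G U v = degIn G (leaves G U) v
      + #{u ∈ {u ∈ U | G.Adj v u} | ¬ degIn G U u = 1} := by
    rw [degIn, degIn, leaves, Finset.filter_comm, Finset.card_filter_add_card_filter_not]
  rw [hsplit]
  by_contra! hlt
  have hcard : 2 < #{u ∈ {u ∈ U | G.Adj v u} | ¬ degIn G U u = 1} := by
    have := hlt
    linarith
  obtain ⟨y₁, h₁, y₂, h₂, y₃, h₃, h₁₂, h₁₃, h₂₃⟩ := Finset.two_lt_card.1 hcard
  have hz : ∀ u ∈ {u ∈ {u ∈ U | G.Adj v u} | ¬ degIn G U u = 1},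
      ∃ z, G.Adj o z ∧ G.Adj u z ∧ z ≠ v := by
    intro u hu
    simp only [Finset.mem_filter] at hu
    have hvu : v ∈ ({z ∈ U | G.Adj u z} : Finset V) :=
      Finset.mem_filter.2 ⟨(hmem v).2 hv, hu.1.2.symm⟩
    have hpos : 0 < degIn G U u := Finset.card_pos.2 ⟨v, hvu⟩
    obtain ⟨z, hz, hzv⟩ := Finset.exists_mem_ne (by have := hu.2; unfold degIn at *; omega :
      1 < #({z ∈ U | G.Adj u z} : Finset V)) v
    rw [Finset.mem_filter, hmem] at hz
    exact ⟨z, hz.1, hz.2, hzv⟩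
  obtain ⟨z₁, oz₁, yz₁, zv₁⟩ := hz y₁ h₁
  obtain ⟨z₂, oz₂, yz₂, zv₂⟩ := hz y₂ h₂
  obtain ⟨z₃, oz₃, yz₃, zv₃⟩ := hz y₃ h₃
  simp only [Finset.mem_filter, hmem] at h₁ h₂ h₃
  obtain ⟨b, c, d, hb, hc, hd, hD⟩ := h.exists_isDiamond hv h₁.1.1 h₂.1.1 h₃.1.1 oz₁ oz₂ oz₃
    h₁.1.2 h₂.1.2 h₃.1.2 yz₁ yz₂ yz₃ zv₁ zv₂ zv₃ h₁₂ h₁₃ h₂₃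
  exact hcen b c d hb hc hd hD

/-- A four-element union of components of `G[N(o)]` with all degrees two or three. -/
structure IsBlock (G : SimpleGraph V) [DecidableRel G.Adj] (o : V) (S : Finset V) : Prop where
  subset : S ⊆ G.neighborFinset o
  card_eq : #S = 4
  closed : ∀ v ∈ S, ∀ u ∈ G.neighborFinset o, G.Adj v u → u ∈ S
  two_le : ∀ v ∈ S, 2 ≤ degIn G (G.neighborFinset o) v
  le_three : ∀ v ∈ S, degIn G (G.neighborFinset o) v ≤ 3

theorem IsFourCycle.isBlock (h : F6Free G) {o a b c d : V} (hC : IsFourCycle G a b c d)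
    (ha : G.Adj o a) (hb : G.Adj o b) (hc : G.Adj o c) (hd : G.Adj o d) :
    IsBlock G o {a, b, c, d} := by
  obtain ⟨hab, hbc, hcd, hda, hac, hbd⟩ := id hC
  have hcl : ∀ v ∈ ({a, b, c, d} : Finset V), ∀ u ∈ G.neighborFinset o, G.Adj v u →
      u ∈ ({a, b, c, d} : Finset V) := by
    intro v hv u hu hvu
    rw [G.mem_neighborFinset] at hu
    simp only [Finset.mem_insert, Finset.mem_singleton] at hv ⊢
    rcases hv with rfl | rfl | rfl | rfl
    · have := hC.mem_of_adj_first h ha hb hc hd hu hvu; tauto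
    · have := hC.rotate.mem_of_adj_first h hb hc hd ha hu hvu; tauto
    · have := hC.rotate.rotate.mem_of_adj_first h hc hd ha hb hu hvu; tauto
    · have := hC.rotate.rotate.rotate.mem_of_adj_first h hd ha hb hc hu hvu; tauto
  have hcard : #({a, b, c, d} : Finset V) = 4 := by
    simp [*, hab.ne, hbc.ne, hcd.ne, hda.ne']
  refine ⟨?_, hcard, hcl, ?_, ?_⟩
  · intro v hv
    rw [G.mem_neighborFinset]
    simp only [Finset.mem_insert, Finset.mem_singleton] at hv
    rcases hv with rfl | rfl | rfl | rfl <;> assumption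
  · have aux : ∀ v p q, G.Adj o p → G.Adj o q → G.Adj v p → G.Adj v q → p ≠ q →
        2 ≤ degIn G (G.neighborFinset o) v := by
      intro v p q hp hq hvp hvq hpq
      refine Finset.one_lt_card.2 ⟨p, ?_, q, ?_, hpq⟩ <;> simp [*]
    intro v hv
    simp only [Finset.mem_insert, Finset.mem_singleton] at hv
    rcases hv with rfl | rfl | rfl | rfl
    · exact aux v b d hb hd hab hda.symm hbd
    · exact aux v a c ha hc hab.symm hbc hac
    · exact aux v b d hb hd hbc.symm hcd hbd
    · exact aux v a c ha hc hda hcd.symm hac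
  · intro v hv
    have : degIn G (G.neighborFinset o) v ≤ #(({a, b, c, d} : Finset V).erase v) := by
      refine Finset.card_le_card fun u hu => ?_
      rw [Finset.mem_filter] at hu
      exact Finset.mem_erase.2 ⟨hu.2.ne', hcl v hv u hu.1 hu.2⟩
    rwa [Finset.card_erase_of_mem hv, hcard] at this

theorem IsFourCycle.degIn_le_two_of_not_adj (h : F6Free G) {o a b c d : V}
    (hC : IsFourCycle G a b c d)
    (ha : G.Adj o a) (hb : G.Adj o b) (hc : G.Adj o c) (hd : G.Adj o d)
    (hac : ¬ G.Adj a c) (hbd : ¬ G.Adj b d) {v : V} (hv : v ∈ ({a, b, c, d} : Finset V)) :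
    degIn G (G.neighborFinset o) v ≤ 2 := by
  have hB := hC.isBlock h ha hb hc hd
  have aux : ∃ p q, ({u ∈ G.neighborFinset o | G.Adj v u} : Finset V) ⊆ {p, q} := by
    have hsub : ∀ u ∈ ({u ∈ G.neighborFinset o | G.Adj v u} : Finset V),
        G.Adj v u ∧ u ∈ ({a, b, c, d} : Finset V) := fun u hu =>
      ⟨(Finset.mem_filter.1 hu).2,
        hB.closed v hv u (Finset.mem_filter.1 hu).1 (Finset.mem_filter.1 hu).2⟩
    have hca : ¬ G.Adj c a := fun e => hac e.symm
    have hdb : ¬ G.Adj d b := fun e => hbd e.symm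
    have hirr : ∀ u, ¬ G.Adj u u := fun u => G.loopless.irrefl u
    simp only [Finset.mem_insert, Finset.mem_singleton] at hv hsub
    rcases hv with rfl | rfl | rfl | rfl
    · exact ⟨b, d, by grind⟩
    · exact ⟨a, c, by grind⟩
    · exact ⟨b, d, by grind⟩
    · exact ⟨a, c, by grind⟩
  obtain ⟨p, q, hpq⟩ := aux
  exact (Finset.card_le_card hpq).trans Finset.card_le_two

theorem IsDiamond.subset_of_mem {o a b c d v : V} {S : Finset V} (hS : IsBlock G o S)
    (hD : IsDiamond G a b c d) (ha : G.Adj o a) (hb : G.Adj o b) (hc : G.Adj o c)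
    (hd : G.Adj o d) (hv : v ∈ ({a, b, c, d} : Finset V)) (hvS : v ∈ S) :
    {a, b, c, d} ⊆ S := by
  obtain ⟨hab, hac, had, -, -, -⟩ := hD
  have haS : a ∈ S := by
    simp only [Finset.mem_insert, Finset.mem_singleton] at hv
    rcases hv with rfl | rfl | rfl | rfl
    · exact hvS
    all_goals exact hS.closed _ hvS a (by simpa) (SimpleGraph.Adj.symm (by assumption))
  have h2 := hS.closed a haS b (by simpa) hab
  have h3 := hS.closed a haS c (by simpa) hac
  have h4 := hS.closed a haS d (by simpa) had
  simp [Finset.insert_subset_iff, *]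

variable (G) in
/-- The vertex sets of the copies of `K₄ - e` in `G[N(o)]`. -/
noncomputable def diamonds (o : V) : Finset (Finset V) :=
  {Q | ∃ a b c d, Q = {a, b, c, d} ∧ IsDiamond G a b c d ∧
    G.Adj o a ∧ G.Adj o b ∧ G.Adj o c ∧ G.Adj o d}

theorem isBlock_of_mem_diamonds (h : F6Free G) {o : V} {Q : Finset V} (hQ : Q ∈ diamonds G o) :
    IsBlock G o Q := by
  obtain ⟨a, b, c, d, rfl, hD, ha, hb, hc, hd⟩ := (Finset.mem_filter.1 hQ).2
  have := hD.isFourCycle.isBlock h ha hc hb hd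
  rwa [Finset.insert_comm c b] at this

theorem degIn_le_two_of_mem_diamonds (h : F6Free G) {o w : V} {Q : Finset V}
    (hQ : Q ∈ diamonds G o) (hw : w ∈ outer G o) : degIn G Q w ≤ 2 := by
  obtain ⟨a, b, c, d, rfl, hD, ha, hb, hc, hd⟩ := (Finset.mem_filter.1 hQ).2
  simp only [outer, Finset.mem_filter] at hw
  exact hD.degIn_le_two h ha hb hc hd hw.2.1 hw.2.2

theorem eq_of_mem_diamonds (h : F6Free G) {o v : V} {Q S : Finset V} (hQ : Q ∈ diamonds G o)
    (hS : IsBlock G o S) (hv : v ∈ Q) (hvS : v ∈ S) : Q = S := by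
  refine Finset.eq_of_subset_of_card_le ?_
    (by rw [hS.card_eq, (isBlock_of_mem_diamonds h hQ).card_eq])
  obtain ⟨a, b, c, d, rfl, hD, ha, hb, hc, hd⟩ := (Finset.mem_filter.1 hQ).2
  exact hD.subset_of_mem hS ha hb hc hd hv hvS

theorem disjoint_of_mem_diamonds (h : F6Free G) {o : V} {Q S : Finset V} (hQ : Q ∈ diamonds G o)
    (hS : IsBlock G o S) (hdeg : ∀ v ∈ S, degIn G (G.neighborFinset o) v ≤ 2) :
    Disjoint Q S := by
  rw [Finset.disjoint_left]
  intro v hv hvS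
  obtain rfl := eq_of_mem_diamonds h hQ hS hv hvS
  obtain ⟨a, b, c, d, rfl, ⟨hab, hac, had, hbc, hbd, hcd⟩, ha, hb, hc, hd⟩ :=
    (Finset.mem_filter.1 hQ).2
  have h1 := hdeg a (by simp)
  have h2 : 2 < degIn G (G.neighborFinset o) a :=
    Finset.two_lt_card.2 ⟨b, by simp [*], c, by simp [*], d, by simp [*], hbc.ne, hbd.ne, hcd⟩
  omega

namespace IsBlock

variable {lam : ℝ} {y : V → ℝ} {o : V} {S : Finset V}

theorem sum_excess_le (hS : IsBlock G o S) (h0 : ∀ v, 0 ≤ y v) (h1 : ∀ v, y v ≤ 1) :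
    ∑ v ∈ S, excess G (G.neighborFinset o) y v ≤ 3 / 2 * ∑ v ∈ S, y v - 4 := by
  have : ∀ v ∈ S, excess G (G.neighborFinset o) y v ≤ 3 / 2 * y v - 1 := by
    intro v hv
    have h2 := hS.two_le v hv
    have h3 := hS.le_three v hv
    have := h0 v
    have := h1 v
    unfold excess
    interval_cases degIn G (G.neighborFinset o) v <;> norm_num <;> linarith
  refine (Finset.sum_le_sum this).trans_eq ?_
  rw [Finset.sum_sub_distrib, Finset.mul_sum]
  simp [hS.card_eq]

theorem sum_excess_of_degree_two (hS : IsBlock G o S)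
    (hdeg : ∀ v ∈ S, degIn G (G.neighborFinset o) v ≤ 2) :
    ∑ v ∈ S, excess G (G.neighborFinset o) y v = ∑ v ∈ S, y v - 4 := by
  have : ∀ v ∈ S, excess G (G.neighborFinset o) y v = y v - 1 := by
    intro v hv
    have : degIn G (G.neighborFinset o) v = 2 := le_antisymm (hdeg v hv) (hS.two_le v hv)
    unfold excess
    rw [this]
    norm_num
  rw [Finset.sum_congr rfl this, Finset.sum_sub_distrib]
  simp [hS.card_eq]

/-- A block of large weight has many outer neighbours, which contradicts the deficiency
inequality. -/
theorem false_of_le_sum (hS : IsBlock G o S) (hy : IsMaxNormalizedEigenvector G lam y o)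
    (hlam : 48 / 5 ≤ lam) (hsum : 8 / 3 ≤ ∑ v ∈ S, y v) {w₀ : V}
    (hw₀ : ∀ w ∈ outer G o, w ≠ w₀ → degIn G S w ≤ 2) {R : ℝ} (hR : 0 ≤ R)
    (hlow : ∀ w ∈ outer G o, w ≠ w₀ → R - degIn G (outer G o) w ≤ lam * (1 - y w))
    (hup : ∑ w ∈ outer G o, ((degIn G (G.neighborFinset o) w : ℝ) * (1 - y w)
        + (degIn G (outer G o) w : ℝ) / 2) ≤ R - 1) : False := by
  have hmany := hy.le_sum_outer_degIn hS.subset hS.closed hS.le_three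
  rw [hS.card_eq] at hmany
  have hcard : ∀ w, (degIn G S w : ℝ) ≤ 4 := by
    intro w
    rw [← Nat.cast_ofNat, ← hS.card_eq]
    exact_mod_cast Finset.card_filter_le _ _
  have hmany' : lam ≤ ∑ w ∈ outer G o with w ≠ w₀, (degIn G S w : ℝ) := by
    have h1 : ∑ w ∈ outer G o with ¬ w ≠ w₀, (degIn G S w : ℝ) ≤ 4 := by
      have : ({w ∈ outer G o | ¬ w ≠ w₀} : Finset V) ⊆ {w₀} := by
        intro w; simp
      refine (Finset.sum_le_sum_of_subset_of_nonneg this (fun _ _ _ => Nat.cast_nonneg _)).trans ?_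
      simpa using hcard w₀
    have h2 := Finset.sum_filter_add_sum_filter_not (outer G o) (fun w => w ≠ w₀)
      (fun w => (degIn G S w : ℝ))
    push_cast at hmany
    nlinarith
  set t : V → ℝ := fun w => (degIn G (G.neighborFinset o) w : ℝ) * (1 - y w)
        + (degIn G (outer G o) w : ℝ) / 2 with ht
  have hsub : ∑ w ∈ outer G o with w ≠ w₀, t w ≤ ∑ w ∈ outer G o, t w := by
    refine Finset.sum_le_sum_of_subset_of_nonneg (Finset.filter_subset _ _) fun w _ _ => ?_
    have := hy.le_one w
    have : 0 ≤ 1 - y w := by linarith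
    positivity
  have hterm : R * ∑ w ∈ outer G o with w ≠ w₀, (degIn G S w : ℝ)
      ≤ lam * ∑ w ∈ outer G o with w ≠ w₀, t w := by
    rw [Finset.mul_sum, Finset.mul_sum]
    refine Finset.sum_le_sum fun w hw => ?_
    rw [Finset.mem_filter] at hw
    have h1 := hlow w hw.1 hw.2
    have h2 : (degIn G S w : ℝ) ≤ 2 := by exact_mod_cast hw₀ w hw.1 hw.2
    have h3 : (degIn G S w : ℝ) ≤ degIn G (G.neighborFinset o) w := by
      exact_mod_cast degIn_mono G hS.subset w
    have h4 : (0 : ℝ) ≤ degIn G S w := Nat.cast_nonneg _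
    have h5 : (0 : ℝ) ≤ degIn G (outer G o) w := Nat.cast_nonneg _
    have h6 : 0 ≤ lam * (1 - y w) := mul_nonneg (by linarith) (by linarith [hy.le_one w])
    have h7 := mul_le_mul_of_nonneg_left h1 h4
    have h8 := mul_le_mul_of_nonneg_right h3 h6
    have h9 : (degIn G S w : ℝ) * degIn G (outer G o) w ≤ lam / 2 * degIn G (outer G o) w :=
      mul_le_mul_of_nonneg_right (by linarith) h5
    simp only [ht]
    nlinarith
  nlinarith

theorem sum_sub_degIn_le (hy : ∀ v, y v ≤ 1) (S : Finset V) (w : V) :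
    ∑ v ∈ S, y v - degIn G S w ≤ ∑ v ∈ S with ¬ G.Adj w v, y v := by
  rw [← Finset.sum_filter_add_sum_filter_not S (fun v => G.Adj w v)]
  have : ∑ v ∈ S with G.Adj w v, y v ≤ degIn G S w := by
    refine (Finset.sum_le_sum fun v _ => hy v).trans ?_
    simp [degIn]
  linarith

end IsBlock

theorem F6Free.not_isFourCycle_of_not_adj (h : F6Free G) {lam : ℝ} {y : V → ℝ} {o a b c d : V}
    (hy : IsMaxNormalizedEigenvector G lam y o) (hlam : 48 / 5 ≤ lam)
    (hm : (G.edgeSet.ncard : ℝ) - 1 ≤ lam ^ 2 - lam)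
    (ha : G.Adj o a) (hb : G.Adj o b) (hc : G.Adj o c) (hd : G.Adj o d)
    (hac : ¬ G.Adj a c) (hbd : ¬ G.Adj b d) : ¬ IsFourCycle G a b c d := by
  intro hC
  have hCB := hC.isBlock h ha hb hc hd
  have hdeg : ∀ v ∈ ({a, b, c, d} : Finset V), degIn G (G.neighborFinset o) v ≤ 2 :=
    fun v hv => hC.degIn_le_two_of_not_adj h ha hb hc hd hac hbd hv
  obtain ⟨w₀, hw₀⟩ : ∃ w₀, ∀ w ∈ outer G o, w ≠ w₀ → degIn G {a, b, c, d} w ≤ 2 := by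
    by_cases hex : ∃ w ∈ outer G o, 3 ≤ degIn G {a, b, c, d} w
    · obtain ⟨w₀, hw₀, hlt⟩ := hex
      refine ⟨w₀, fun w hw hne => ?_⟩
      simp only [outer, Finset.mem_filter] at hw hw₀
      exact hC.degIn_le_two h ha hb hc hd hw₀.2.1 hw₀.2.2 hw.2.1 hw.2.2 hne.symm hlt
    · push Not at hex
      exact ⟨o, fun w hw _ => Nat.le_of_lt_succ (hex w hw)⟩
  set C : Finset V := {a, b, c, d} with hCdef
  set β : Finset V → ℝ := fun Q => if 8 / 3 ≤ ∑ v ∈ Q, y v then ∑ v ∈ Q, y v - 2 else 0 with hβ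
  set βC : ℝ := max (∑ v ∈ C, y v - 2) 0 with hβC
  have hβ0 : ∀ Q, 0 ≤ β Q := by
    intro Q
    simp only [hβ]
    split_ifs <;> linarith
  have hpair : (diamonds G o : Set (Finset V)).PairwiseDisjoint id := by
    intro Q hQ Q' hQ' hne
    rw [Function.onFun, id, id, Finset.disjoint_left]
    exact fun v hv hv' => hne (eq_of_mem_diamonds h hQ (isBlock_of_mem_diamonds h hQ') hv hv')
  have hdisj : Disjoint C ((diamonds G o).biUnion id) := by
    rw [Finset.disjoint_biUnion_right]
    exact fun Q hQ => (disjoint_of_mem_diamonds h hQ hCB hdeg).symm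
  set B : Finset V := C ∪ (diamonds G o).biUnion id with hB
  have hBU : B ⊆ G.neighborFinset o :=
    Finset.union_subset hCB.subset
      (Finset.biUnion_subset.2 fun Q hQ => (isBlock_of_mem_diamonds h hQ).subset)
  have hBsum : ∀ g : V → ℝ, ∑ v ∈ B, g v = ∑ v ∈ C, g v + ∑ Q ∈ diamonds G o, ∑ v ∈ Q, g v := by
    intro g
    rw [hB, Finset.sum_union hdisj, Finset.sum_biUnion hpair]
    rfl
  have hgamma : ∑ v ∈ G.neighborFinset o, excess G (G.neighborFinset o) y v
      ≤ ∑ v ∈ C, y v - 4 + ∑ Q ∈ diamonds G o, β Q := by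
    refine (sum_excess_le hy.nonneg hy.le_one hBU ?_ ?_).trans ?_
    · intro v hv
      simp only [hB, Finset.mem_union, Finset.mem_biUnion] at hv
      rcases hv with hv | ⟨Q, hQ, hv⟩
      · exact hCB.two_le v hv
      · exact (isBlock_of_mem_diamonds h hQ).two_le v hv
    · intro v hv hvB
      rw [G.mem_neighborFinset] at hv
      refine h.degIn_le_degIn_leaves_add_two hv fun b' c' d' hb' hc' hd' hD => hvB ?_
      refine Finset.mem_union_right _ (Finset.mem_biUnion.2 ⟨{v, b', c', d'}, ?_, by simp⟩)
      exact Finset.mem_filter.2 ⟨Finset.mem_univ _, v, b', c', d', rfl, hD, hv, hb', hc', hd'⟩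
    · rw [hBsum, hCB.sum_excess_of_degree_two hdeg]
      gcongr with Q hQ
      have hQB := isBlock_of_mem_diamonds h hQ
      have h1 := hQB.sum_excess_le hy.nonneg hy.le_one
      have h2 : ∑ v ∈ Q, y v ≤ 4 := by
        refine (Finset.sum_le_sum fun v _ => hy.le_one v).trans ?_
        simp [hQB.card_eq]
      simp only [hβ]
      split_ifs with hs <;> linarith
  have hup := hy.sum_outer_le hm
  have hnonneg : 0 ≤ ∑ w ∈ outer G o, ((degIn G (G.neighborFinset o) w : ℝ) * (1 - y w)
        + (degIn G (outer G o) w : ℝ) / 2) := by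
    refine Finset.sum_nonneg fun w _ => ?_
    have : 0 ≤ 1 - y w := by linarith [hy.le_one w]
    positivity
  set R : ℝ := βC + ∑ Q ∈ diamonds G o, β Q with hRdef
  have hβCle : ∑ v ∈ C, y v - 2 ≤ βC := le_max_left _ _
  have hup' := hup.trans (add_le_add_right hgamma 1)
  have hR : 1 ≤ R := by linarith
  have hlow : ∀ w ∈ outer G o, w ≠ w₀ → R - degIn G (outer G o) w ≤ lam * (1 - y w) := by
    intro w hw hne
    have h1 := hy.sum_nonadj_sub_le hw
    have h2 : ∑ v ∈ B with ¬ G.Adj w v, y v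
        ≤ ∑ v ∈ G.neighborFinset o with ¬ G.Adj w v, y v :=
      Finset.sum_le_sum_of_subset_of_nonneg (Finset.filter_subset_filter _ hBU)
        fun v _ _ => hy.nonneg v
    have hnn : ∀ Q : Finset V, 0 ≤ ∑ v ∈ Q with ¬ G.Adj w v, y v :=
      fun Q => Finset.sum_nonneg fun v _ => hy.nonneg v
    have h3 : βC ≤ ∑ v ∈ C with ¬ G.Adj w v, y v := by
      refine max_le ?_ (hnn C)
      have h4 := IsBlock.sum_sub_degIn_le (G := G) hy.le_one C w
      have h5 : (degIn G C w : ℝ) ≤ 2 := by exact_mod_cast hw₀ w hw hne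
      linarith
    have h6 : ∑ Q ∈ diamonds G o, β Q
        ≤ ∑ Q ∈ diamonds G o, ∑ v ∈ Q with ¬ G.Adj w v, y v := by
      refine Finset.sum_le_sum fun Q hQ => ?_
      have h4 := IsBlock.sum_sub_degIn_le (G := G) hy.le_one Q w
      have h5 : (degIn G Q w : ℝ) ≤ 2 := by exact_mod_cast degIn_le_two_of_mem_diamonds h hQ hw
      have h7 := hnn Q
      simp only [hβ]
      split_ifs <;> linarith
    have h8 := hBsum (fun v => if ¬ G.Adj w v then y v else 0)
    simp only [← Finset.sum_filter] at h8
    linarith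
  by_cases hrich : ∃ Q ∈ diamonds G o, 8 / 3 ≤ ∑ v ∈ Q, y v
  · obtain ⟨Q, hQ, hs⟩ := hrich
    exact (isBlock_of_mem_diamonds h hQ).false_of_le_sum hy hlam hs
      (fun w hw _ => degIn_le_two_of_mem_diamonds h hQ hw) (by linarith) hlow (by linarith)
  · have hzero : ∑ Q ∈ diamonds G o, β Q = 0 :=
      Finset.sum_eq_zero fun Q hQ => if_neg fun hs => hrich ⟨Q, hQ, hs⟩
    exact hCB.false_of_le_sum hy hlam (by linarith) hw₀ (by linarith) hlow (by linarith)

end Block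

theorem stmt_16 
    {V : Type} [Fintype V] [DecidableEq V] (G : SimpleGraph V) [DecidableRel G.Adj]
    (m : ℕ) (hm : 88 ≤ m)
    (hfree : F6Free G)
    (hcard : G.edgeSet.ncard = m)
    (hnoiso : ∀ v : V, ∃ w, G.Adj v w)
    (hmax : ∀ (n : ℕ) (G' : SimpleGraph (Fin n)), F6Free G' → G'.edgeSet.ncard = m →
      (∀ v, ∃ w, G'.Adj v w) → specRad G' ≤ specRad G)
    (lam : ℝ) (hlam : lam = specRad G)
    (hconn : G.Connected)
    (hlow : (1 + Real.sqrt (4 * (m : ℝ) - 3)) / 2 ≤ lam)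
    (x : V → ℝ) (hxpos : ∀ v, 0 < x v)
    (heig : (G.adjMatrix ℝ).mulVec x = lam • x)
    (ustar : V) (hustar : ∀ v, x v ≤ x ustar)
    :
    ∀ C : (G.induce (G.neighborSet ustar)).ConnectedComponent,
      ¬ Nonempty ((G.induce (Subtype.val '' C.supp)) ≃g SimpleGraph.cycleGraph 4) := by
  rintro C ⟨e⟩
  set p : Fin 4 → V := fun i => (e.symm i).1
  have hp : ∀ i, G.Adj ustar (p i) := by
    intro i
    obtain ⟨u, -, hu⟩ := (e.symm i).2
    have := u.2
    rwa [hu] at this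
  have hadj : ∀ i j, G.Adj (p i) (p j) ↔ (SimpleGraph.cycleGraph 4).Adj i j :=
    fun i j => e.symm.map_adj_iff
  have hinj : Function.Injective p := Subtype.val_injective.comp e.symm.injective
  have hm' : (88 : ℝ) ≤ m := by exact_mod_cast hm
  have hsq := Real.sq_sqrt (show (0 : ℝ) ≤ 4 * (m : ℝ) - 3 by linarith)
  have hsqrt : (91 / 5 : ℝ) ≤ Real.sqrt (4 * (m : ℝ) - 3) :=
    Real.le_sqrt_of_sq_le (by norm_num; linarith)
  have hpos := hxpos ustar
  have hy : IsMaxNormalizedEigenvector G lam (fun v => x v / x ustar) ustar := by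
    refine ⟨fun v => ?_, fun v => (div_pos (hxpos v) hpos).le,
      fun v => (div_le_one hpos).2 (hustar v), div_self hpos.ne'⟩
    have := congrFun heig v
    rw [SimpleGraph.adjMatrix_mulVec_apply, Pi.smul_apply, smul_eq_mul] at this
    rw [← mul_div_assoc, ← this, SimpleGraph.neighborFinset_eq_filter, Finset.sum_filter,
      Finset.sum_div]
    exact Finset.sum_congr rfl fun u _ => by split_ifs <;> simp
  refine hfree.not_isFourCycle_of_not_adj hy (by linarith) ?_ (hp 0) (hp 1) (hp 2) (hp 3)
    ?_ ?_ ⟨?_, ?_, ?_, ?_, hinj.ne (by decide), hinj.ne (by decide)⟩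
  · rw [hcard]
    nlinarith
  all_goals
    rw [hadj, SimpleGraph.cycleGraph_adj]
    decide
end

section
/- Let G be an F6-free graph, let u* be a vertex of G, and let u1, u2, u3, u4 be four distinct neighbors of u* forming a 4-cycle u1u2u3u4u1 in G. Then there is at most one vertex w ∈ V(G) \ N[u*] having at least three neighbors among {u1, u2, u3, u4}. -/
open SimpleGraph Finset
open scoped Classical

/-- In an `F₆`-free graph no vertex `h` is adjacent to all vertices of a path on five vertices. -/
lemma F6Free.not_nodup_of_path {V : Type*} {G : SimpleGraph V} (hfree : F6Free G)
    {a b c d e h : V} (hab : G.Adj a b) (hbc : G.Adj b c) (hcd : G.Adj c d) (hde : G.Adj d e)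
    (ha : G.Adj h a) (hb : G.Adj h b) (hc : G.Adj h c) (hd : G.Adj h d) (he : G.Adj h e) :
    ¬ ([a, b, c, d, e] : List V).Nodup := by
  intro hn
  have hadj : ∀ i j, fan6.Adj i j →
      G.Adj ((![a, b, c, d, e, h] : Fin 6 → V) i) ((![a, b, c, d, e, h] : Fin 6 → V) j) := by
    intro i j hij
    rw [fan6, SimpleGraph.fromRel_adj] at hij
    fin_cases i <;> fin_cases j <;>
      first
      | (exfalso; revert hij; decide)
      | assumption
      | (apply SimpleGraph.Adj.symm; assumption)
  refine hfree ⟨⟨![a, b, c, d, e, h], fun {i j} => hadj i j⟩, ?_⟩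
  have hne : ∀ i j : Fin 6, i < j →
      (![a, b, c, d, e, h] : Fin 6 → V) i ≠ (![a, b, c, d, e, h] : Fin 6 → V) j := by
    have := ha.ne'
    have := hb.ne'
    have := hc.ne'
    have := hd.ne'
    have := he.ne'
    simp only [List.nodup_cons, List.mem_cons, List.not_mem_nil, or_false, not_or] at hn
    intro i j hij
    fin_cases i <;> fin_cases j <;> simp_all
  intro i j hij
  rcases lt_trichotomy i j with hlt | heq | hlt
  · exact absurd hij (hne i j hlt)
  · exact heq
  · exact absurd hij.symm (hne j i hlt)

/-- A vertex with three neighbors in a set of at most four vertices misses at most one of them. -/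
lemma adj_of_three_le_ncard {V : Type*} {G : SimpleGraph V} {w a b c d : V}
    (h : 3 ≤ {v ∈ ({a, b, c, d} : Set V) | G.Adj w v}.ncard) : G.Adj w a ∨ G.Adj w b := by
  by_contra! hab
  have hsub : {v ∈ ({a, b, c, d} : Set V) | G.Adj w v} ⊆ {c, d} := by
    rintro v ⟨rfl | rfl | hv, hwv⟩
    · exact absurd hwv hab.1
    · exact absurd hwv hab.2
    · exact hv
  have := Set.ncard_le_ncard hsub (Set.toFinite _)
  have := Set.ncard_insert_le c {d}
  have := Set.ncard_singleton d
  omega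

theorem stmt_17 {V : Type} (G : SimpleGraph V) (hfree : F6Free G) (ustar : V)
    (u1 u2 u3 u4 : V) (hnodup : ([u1, u2, u3, u4] : List V).Nodup)
    (h1 : G.Adj ustar u1) (h2 : G.Adj ustar u2) (h3 : G.Adj ustar u3)
    (h4 : G.Adj ustar u4)
    (c12 : G.Adj u1 u2) (c23 : G.Adj u2 u3) (c34 : G.Adj u3 u4) (c41 : G.Adj u4 u1) :
    {w : V | w ∈ (insert ustar (G.neighborSet ustar))ᶜ ∧
      3 ≤ {v ∈ ({u1, u2, u3, u4} : Set V) | G.Adj w v}.ncard}.Subsingleton := by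
  simp only [List.nodup_cons, List.mem_cons, List.not_mem_nil, or_false] at hnodup
  rintro w ⟨hw, hw3⟩ w' ⟨hw', hw3'⟩
  by_contra hne
  simp only [Set.mem_compl_iff, Set.mem_insert_iff, SimpleGraph.mem_neighborSet, not_or] at hw hw'
  have miss : ∀ z, 3 ≤ {v ∈ ({u1, u2, u3, u4} : Set V) | G.Adj z v}.ncard →
      (G.Adj z u1 ∨ G.Adj z u2) ∧ (G.Adj z u1 ∨ G.Adj z u3) ∧ (G.Adj z u1 ∨ G.Adj z u4) ∧
      (G.Adj z u2 ∨ G.Adj z u3) ∧ (G.Adj z u2 ∨ G.Adj z u4) ∧ (G.Adj z u3 ∨ G.Adj z u4) := by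
    intro z hz
    refine ⟨adj_of_three_le_ncard hz,
      adj_of_three_le_ncard (c := u2) (d := u4) ?_, adj_of_three_le_ncard (c := u2) (d := u3) ?_,
      adj_of_three_le_ncard (c := u1) (d := u4) ?_, adj_of_three_le_ncard (c := u1) (d := u3) ?_,
      adj_of_three_le_ncard (c := u1) (d := u2) ?_⟩ <;>
    · convert hz using 4
      simp only [Set.mem_insert_iff, Set.mem_singleton_iff]
      tauto
  have no_fan : ∀ a b c x y, a ≠ c → x ≠ y → G.Adj ustar a → G.Adj ustar b → G.Adj ustar c →
      G.Adj a b → G.Adj b c → ustar ≠ x → ¬ G.Adj ustar x → ustar ≠ y → ¬ G.Adj ustar y →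
      G.Adj x a → G.Adj x b → G.Adj y b → G.Adj y c → False := by
    intro a b c x y hac hxy ha hb hc hab hbc hx hx' hy hy' hxa hxb hyb hyc
    refine hfree.not_nodup_of_path hxa ha.symm hc hyc.symm hxb.symm hab.symm hb.symm hbc
      hyb.symm ?_
    have hxc : x ≠ c := by rintro rfl; exact hx' hc
    have hay : a ≠ y := by rintro rfl; exact hy' ha
    simp [hxa.ne, hx.symm, hxc, hxy, ha.ne', hac, hay, hc.ne, hy, hyc.ne']
  have hm := miss w hw3
  have hm' := miss w' hw3'
  have hw0 : ustar ≠ w := fun h => hw.1 h.symm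
  have hw0' : ustar ≠ w' := fun h => hw'.1 h.symm
  have n13 : u1 ≠ u3 := fun h => hnodup.1 (.inr (.inl h))
  have n24 : u2 ≠ u4 := fun h => hnodup.2.1 (.inr h)
  have at1 := no_fan u4 u1 u2 w w' n24.symm hne h4 h1 h2 c41 c12 hw0 hw.2 hw0' hw'.2
  have at2 := no_fan u1 u2 u3 w w' n13 hne h1 h2 h3 c12 c23 hw0 hw.2 hw0' hw'.2
  have at3 := no_fan u2 u3 u4 w w' n24 hne h2 h3 h4 c23 c34 hw0 hw.2 hw0' hw'.2
  have at4 := no_fan u3 u4 u1 w w' n13.symm hne h3 h4 h1 c34 c41 hw0 hw.2 hw0' hw'.2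
  have at1' := no_fan u4 u1 u2 w' w n24.symm (Ne.symm hne) h4 h1 h2 c41 c12 hw0' hw'.2 hw0 hw.2
  have at2' := no_fan u1 u2 u3 w' w n13 (Ne.symm hne) h1 h2 h3 c12 c23 hw0' hw'.2 hw0 hw.2
  have at3' := no_fan u2 u3 u4 w' w n24 (Ne.symm hne) h2 h3 h4 c23 c34 hw0' hw'.2 hw0 hw.2
  have at4' := no_fan u3 u4 u1 w' w n13.symm (Ne.symm hne) h3 h4 h1 c34 c41 hw0' hw'.2 hw0 hw.2
  clear miss no_fan hfree hw3 hw3' hnodup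
  grind
end
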